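/- For every real ε with 0 < ε < 1/2 there exists k₀ such that for every integer k ≥ k₀ there exists a triangle-free simple graph on ⌊(1/2 − ε)·k²/log k⌋ vertices that contains no independent set of size k. (Equivalently, the Ramsey number satisfies R(3,k) > (1/2 − ε)·k²/log k for all k ≥ k₀, i.e., R(3,k) ≥ (1/2 + o(1))·k²/log k.) -/

import Mathlib

namespace TwoBites

open Finset
open scoped BigOperators

section Probability

variable {Ω Ω' : Type*} [Fintype Ω] [Fintype Ω']

open Classical in
/-- The probability of an event under the uniform distribution on a finite type. -/
noncomputable def pr (P : Ω → Prop) : ℝ := 𝔼 ω, if P ω then (1 : ℝ) else 0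

theorem pr_nonneg (P : Ω → Prop) : 0 ≤ pr P :=
  expect_nonneg fun _ _ => by split_ifs <;> norm_num

theorem pr_le_expect {P : Ω → Prop} {F : Ω → ℝ} (h0 : ∀ ω, 0 ≤ F ω) (h1 : ∀ ω, P ω → 1 ≤ F ω) :
    pr P ≤ 𝔼 ω, F ω :=
  expect_le_expect fun ω _ => by
    split_ifs with h
    · exact h1 ω h
    · exact h0 ω

theorem pr_mono {P Q : Ω → Prop} (h : ∀ ω, P ω → Q ω) : pr P ≤ pr Q := by
  classical
  refine pr_le_expect (fun ω => ?_) fun ω hω => ?_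
  · split_ifs <;> norm_num
  · simp [h ω hω]

theorem pr_exists_le {ι : Type*} (s : Finset ι) (P : ι → Ω → Prop) :
    pr (fun ω => ∃ i ∈ s, P i ω) ≤ ∑ i ∈ s, pr (P i) := by
  classical
  unfold pr
  rw [← expect_sum_comm]
  refine expect_le_expect fun ω _ => ?_
  split_ifs with h
  · obtain ⟨i, hi, hP⟩ := h
    refine le_trans ?_ (single_le_sum (f := fun i => if P i ω then (1 : ℝ) else 0)
      (fun j _ => ?_) hi)
    · simp [hP]
    · split_ifs <;> norm_num
  · exact sum_nonneg fun j _ => by split_ifs <;> norm_num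

theorem pr_or_le (P Q : Ω → Prop) : pr (fun ω => P ω ∨ Q ω) ≤ pr P + pr Q := by
  classical
  unfold pr
  rw [← expect_add_distrib]
  refine expect_le_expect fun ω _ => ?_
  by_cases h : P ω <;> by_cases h' : Q ω <;> simp [h, h']

theorem pr_prod (P : Ω × Ω' → Prop) : pr P = 𝔼 a, pr fun b => P (a, b) := by
  classical
  unfold pr
  rw [← univ_product_univ, expect_product]

theorem pr_prod' (P : Ω × Ω' → Prop) : pr P = 𝔼 b, pr fun a => P (a, b) := by
  rw [pr_prod]
  unfold pr
  rw [expect_comm]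

theorem pr_prod_and (P : Ω → Prop) (Q : Ω' → Prop) :
    pr (fun ω : Ω × Ω' => P ω.1 ∧ Q ω.2) = pr P * pr Q := by
  classical
  rw [pr_prod]
  unfold pr
  rw [expect_mul]
  refine expect_congr rfl fun a _ => ?_
  by_cases h : P a <;> simp [h]

theorem expect_le_of_le [Nonempty Ω] {F : Ω → ℝ} {x : ℝ} (h : ∀ ω, F ω ≤ x) : 𝔼 ω, F ω ≤ x :=
  expect_le univ_nonempty fun ω _ => h ω

theorem pr_false_of_le_zero (P : Ω → Prop) (h : ∀ ω, ¬ P ω) : pr P = 0 := by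
  simp [pr, h]

theorem exists_not_of_pr_lt_one [Nonempty Ω] {P : Ω → Prop} (h : pr P < 1) : ∃ ω, ¬ P ω := by
  classical
  by_contra! hP
  have : pr P = 1 := by
    simp [pr, hP]
  linarith

end Probability

section Product

variable {ι : Type*} [Fintype ι] [DecidableEq ι] {b : ℕ} [NeZero b]

theorem expect_prod_eq {α : Type*} [Fintype α] [Nonempty α] (g : ι → α → ℝ) :
    𝔼 c : ι → α, ∏ i, g i (c i) = ∏ i, 𝔼 v, g i v := by
  classical
  simp only [Fintype.expect_eq_sum_div_card, prod_div_distrib]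
  rw [prod_univ_sum, Fintype.piFinset_univ]
  simp only [Fintype.card_pi, Nat.cast_prod]

theorem expect_prod_finset {α : Type*} [Fintype α] [Nonempty α] (S : Finset ι) (g : ι → α → ℝ) :
    𝔼 c : ι → α, ∏ i ∈ S, g i (c i) = ∏ i ∈ S, 𝔼 v, g i v := by
  classical
  have := expect_prod_eq (fun i v => if i ∈ S then g i v else 1)
  have h2 : ∀ c : ι → α, ∏ i ∈ S, g i (c i) = ∏ i, if i ∈ S then g i (c i) else 1 := by
    intro c; rw [prod_ite_mem, univ_inter]
  rw [expect_congr rfl fun c _ => h2 c, this]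
  have h3 : ∏ i ∈ S, 𝔼 v, g i v = ∏ i, if i ∈ S then 𝔼 v, g i v else 1 := by
    rw [prod_ite_mem, univ_inter]
  rw [h3]
  refine prod_congr rfl fun i _ => ?_
  by_cases h : i ∈ S
  · simp only [h, if_true]
  · simp only [h, if_false]
    exact expect_const univ_nonempty 1

theorem expect_ite_eq (v : Fin b) (x y : ℝ) :
    𝔼 w : Fin b, (if w = v then x else y) = y + (1 / b) * (x - y) := by
  have hb : (b : ℝ) ≠ 0 := Nat.cast_ne_zero.mpr (NeZero.ne b)
  have : ∀ w : Fin b, (if w = v then x else y) = y + if w = v then x - y else 0 := by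
    intro w; split_ifs <;> ring
  rw [expect_congr rfl fun w _ => this w, expect_add_distrib]
  rw [Fintype.expect_eq_sum_div_card, Fintype.expect_eq_sum_div_card]
  simp only [sum_ite_eq', mem_univ, if_true, sum_const, card_univ, Fintype.card_fin, nsmul_eq_mul]
  field_simp

theorem pr_all_mem {r : ℕ} [NeZero r] (S : Finset ι) (A : Finset (Fin r)) :
    pr (fun c : ι → Fin r => ∀ e ∈ S, c e ∈ A) = ((#A : ℝ) / r) ^ #S := by
  classical
  have h : ∀ c : ι → Fin r, (if ∀ e ∈ S, c e ∈ A then (1 : ℝ) else 0) =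
      ∏ e ∈ S, if c e ∈ A then 1 else 0 := by
    intro c
    rw [prod_ite_zero]; simp
  unfold pr
  rw [expect_congr rfl fun c _ => by convert h c,
    expect_prod_finset S (fun _ v => if v ∈ A then (1 : ℝ) else 0), prod_const]
  congr 1
  rw [Fintype.expect_eq_sum_div_card]
  simp

theorem pr_all_eq (S : Finset ι) (v : Fin b) :
    pr (fun c : ι → Fin b => ∀ e ∈ S, c e = v) = (1 / b : ℝ) ^ #S := by
  have := pr_all_mem S {v}
  simpa using this

theorem pr_count_ge (N : Finset ι) (v : Fin b) (t : ℕ) :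
    pr (fun c : ι → Fin b => t ≤ #{e ∈ N | c e = v}) ≤ (#N).choose t * (1 / b : ℝ) ^ t := by
  classical
  calc _ ≤ pr (fun c : ι → Fin b => ∃ S ∈ N.powersetCard t, ∀ e ∈ S, c e = v) := by
        refine pr_mono fun c hc => ?_
        obtain ⟨S, hS, hcard⟩ := exists_subset_card_eq hc
        exact ⟨S, mem_powersetCard.mpr ⟨hS.trans (filter_subset _ _), hcard⟩,
          fun e he => (mem_filter.mp (hS he)).2⟩
    _ ≤ ∑ S ∈ N.powersetCard t, pr (fun c : ι → Fin b => ∀ e ∈ S, c e = v) := pr_exists_le _ _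
    _ = ∑ S ∈ N.powersetCard t, (1 / b : ℝ) ^ t :=
        sum_congr rfl fun S hS => by rw [pr_all_eq, (mem_powersetCard.mp hS).2]
    _ = _ := by rw [sum_const, card_powersetCard, nsmul_eq_mul]

theorem choose_le_exp_mul_div_pow (N t : ℕ) :
    ((N.choose t : ℕ) : ℝ) ≤ (Real.exp 1 * N / t) ^ t := by
  rcases Nat.eq_zero_or_pos t with rfl | ht
  · simp
  have ht' : (0 : ℝ) < t := by exact_mod_cast ht
  have h1 := Nat.choose_le_pow_div (α := ℝ) t N
  have h2 := Real.pow_div_factorial_le_exp (t : ℝ) ht'.le t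
  have h3 : (0 : ℝ) < t.factorial := by exact_mod_cast t.factorial_pos
  refine h1.trans ?_
  rw [div_pow, mul_pow, ← Real.exp_nat_mul, mul_one, div_le_div_iff₀ h3 (by positivity)]
  rw [div_le_iff₀ h3] at h2
  nlinarith [pow_nonneg (Nat.cast_nonneg (α := ℝ) N) t]

theorem pr_count_ge' (N : Finset ι) (v : Fin b) (t : ℕ) (m : ℝ) (hm : (#N : ℝ) ≤ m) :
    pr (fun c : ι → Fin b => t ≤ #{e ∈ N | c e = v}) ≤ (Real.exp 1 * m / (b * t)) ^ t := by
  refine (pr_count_ge N v t).trans ?_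
  calc _ ≤ (Real.exp 1 * #N / t) ^ t * (1 / b : ℝ) ^ t := by
        gcongr; exact choose_le_exp_mul_div_pow _ _
    _ ≤ (Real.exp 1 * m / t) ^ t * (1 / b : ℝ) ^ t := by gcongr
    _ = _ := by rw [← mul_pow]; congr 1; rw [div_mul_div_comm, mul_one, mul_comm (t : ℝ)]

theorem pr_all_and_count_le {S N : Finset ι} (hSN : Disjoint S N) (v : Fin b) (t : ℕ) {z : ℝ}
    (hz : 0 < z) (hz1 : z ≤ 1) :
    pr (fun c : ι → Fin b => (∀ e ∈ S, c e = v) ∧ #{e ∈ N | c e = v} ≤ t) ≤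
      (1 / b : ℝ) ^ #S * Real.exp (-((1 / b) * (1 - z) * #N)) * (z⁻¹) ^ t := by
  classical
  have hb : (0 : ℝ) < b := Nat.cast_pos.mpr (NeZero.pos b)
  set g : ι → Fin b → ℝ := fun i w =>
    if i ∈ S then (if w = v then 1 else 0) else (if w = v then z else 1) with hg
  have hg0 : ∀ i w, 0 ≤ g i w := by
    intro i w; simp only [hg]; split_ifs <;> first | exact hz.le | norm_num
  have h1 : pr (fun c : ι → Fin b => (∀ e ∈ S, c e = v) ∧ #{e ∈ N | c e = v} ≤ t) ≤
      𝔼 c : ι → Fin b, (∏ i ∈ S ∪ N, g i (c i)) * (z⁻¹) ^ t := by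
    refine pr_le_expect (fun c => ?_) fun c hc => ?_
    · exact mul_nonneg (prod_nonneg fun i _ => hg0 i _) (by positivity)
    · rw [prod_union hSN]
      have e1 : ∏ i ∈ S, g i (c i) = 1 :=
        prod_eq_one fun i hi => by simp [hg, hi, hc.1 i hi]
      have e2 : ∏ i ∈ N, g i (c i) = z ^ #{e ∈ N | c e = v} := by
        rw [← prod_const, prod_filter]
        refine prod_congr rfl fun i hi => ?_
        have : i ∉ S := fun h => disjoint_left.mp hSN h hi
        simp [hg, this]
      rw [e1, e2, one_mul, inv_pow, ← div_eq_mul_inv, one_le_div (by positivity)]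
      exact pow_le_pow_of_le_one hz.le hz1 hc.2
  refine h1.trans ?_
  rw [← expect_mul, expect_prod_finset, prod_union hSN]
  refine mul_le_mul_of_nonneg_right (mul_le_mul ?_ ?_ ?_ (by positivity)) (by positivity)
  · apply le_of_eq
    rw [← prod_const]
    refine prod_congr rfl fun i hi => ?_
    simp only [hg, hi, if_true]
    rw [expect_ite_eq]; ring
  · rw [show -((1 / (b : ℝ)) * (1 - z) * #N) = #N * (-((1 / (b : ℝ)) * (1 - z))) by ring,
      Real.exp_nat_mul, ← prod_const]
    refine prod_le_prod (fun i _ => expect_nonneg fun w _ => hg0 i w) fun i hi => ?_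
    have : i ∉ S := fun h => disjoint_left.mp hSN h hi
    simp only [hg, this, if_false]
    rw [expect_ite_eq]
    have := Real.add_one_le_exp (-((1 / (b : ℝ)) * (1 - z)))
    linarith
  · exact prod_nonneg fun i _ => expect_nonneg fun w _ => hg0 i w

theorem pr_count_ge_one_add_mul (T : Finset ι) (v : Fin b) {m θ : ℝ} (hθ : 0 ≤ θ) (hθ1 : θ ≤ 1)
    (hm : (#T : ℝ) / b ≤ m) :
    pr (fun c : ι → Fin b => (1 + θ) * m ≤ #{e ∈ T | c e = v}) ≤ Real.exp (-(θ ^ 2 * m / 4)) := by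
  classical
  have hb : (0 : ℝ) < b := Nat.cast_pos.mpr (NeZero.pos b)
  have hm0 : 0 ≤ m := le_trans (by positivity) hm
  set l := θ / 2 with hl
  have h1 : pr (fun c : ι → Fin b => (1 + θ) * m ≤ #{e ∈ T | c e = v}) ≤
      𝔼 c : ι → Fin b, (∏ i ∈ T, if c i = v then Real.exp l else 1) *
        Real.exp (-(l * ((1 + θ) * m))) := by
    refine pr_le_expect (fun c => ?_) fun c hc => ?_
    · refine mul_nonneg (prod_nonneg fun i _ => ?_) (by positivity)
      split_ifs <;> positivity
    · rw [← prod_filter, prod_const, ← Real.exp_nat_mul, ← Real.exp_add]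
      rw [Real.one_le_exp_iff]
      nlinarith
  refine h1.trans ?_
  rw [← expect_mul, expect_prod_finset T (fun _ w => if w = v then Real.exp l else 1), prod_const,
    expect_ite_eq]
  have h2 : Real.exp l ≤ 1 + l + l ^ 2 := by
    have := Real.abs_exp_sub_one_sub_id_le (x := l) (by rw [abs_le]; constructor <;> linarith)
    rw [abs_le] at this
    linarith [this.2]
  have h3 : (1 : ℝ) + 1 / b * (Real.exp l - 1) ≤ Real.exp (1 / b * (l + l ^ 2)) := by
    refine le_trans ?_ (Real.add_one_le_exp _)
    have : 1 / (b : ℝ) * (Real.exp l - 1) ≤ 1 / b * (l + l ^ 2) := by gcongr; linarith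
    linarith
  have h4 : (0 : ℝ) ≤ 1 + 1 / b * (Real.exp l - 1) := by
    have : (0 : ℝ) ≤ Real.exp l - 1 := by linarith [Real.add_one_le_exp l]
    positivity
  calc _ ≤ Real.exp (1 / b * (l + l ^ 2)) ^ #T * Real.exp (-(l * ((1 + θ) * m))) := by gcongr
    _ = Real.exp ((#T / b) * (l + l ^ 2) - l * ((1 + θ) * m)) := by
        rw [← Real.exp_nat_mul, ← Real.exp_add]; congr 1; ring
    _ ≤ _ := by
        rw [Real.exp_le_exp]
        have : (#T / b : ℝ) * (l + l ^ 2) ≤ m * (l + l ^ 2) := by gcongr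
        have h5 : m * (l + l ^ 2) - l * ((1 + θ) * m) = -(θ ^ 2 * m / 4) := by
          rw [hl]; ring
        linarith

theorem pr_card_image_eq {r : ℕ} [NeZero r] (I : Finset ι) (a : ℕ) :
    pr (fun f : ι → Fin r => #(I.image f) = a) ≤ r.choose a * ((a : ℝ) / r) ^ #I := by
  classical
  calc _ ≤ pr (fun f : ι → Fin r => ∃ A ∈ (univ : Finset (Fin r)).powersetCard a,
          ∀ u ∈ I, f u ∈ A) :=
        pr_mono fun f hf => ⟨I.image f, mem_powersetCard.mpr ⟨subset_univ _, hf⟩,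
          fun u hu => mem_image_of_mem f hu⟩
    _ ≤ ∑ A ∈ (univ : Finset (Fin r)).powersetCard a, pr (fun f : ι → Fin r => ∀ u ∈ I, f u ∈ A) :=
        pr_exists_le _ _
    _ = ∑ A ∈ (univ : Finset (Fin r)).powersetCard a, ((a : ℝ) / r) ^ #I :=
        sum_congr rfl fun A hA => by rw [pr_all_mem, (mem_powersetCard.mp hA).2]
    _ = _ := by simp

end Product

section Rows

variable {ι κ ρ α : Type*} [Fintype ι] [DecidableEq ι] [Fintype κ] [DecidableEq κ]
  [Fintype ρ] [DecidableEq ρ] [Fintype α] [Nonempty α]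

theorem expect_comp_injective (e : κ → ι) (he : Function.Injective e) (F : (κ → α) → ℝ) :
    𝔼 c : ι → α, F (fun a => c (e a)) = 𝔼 d : κ → α, F d := by
  classical
  let p : ι → Prop := fun i => i ∈ Set.range e
  let E := Equiv.piEquivPiSubtypeProd p (fun _ => α)
  let E' : ({i // p i} → α) ≃ (κ → α) :=
    (Equiv.ofInjective e he).symm.arrowCongr (Equiv.refl α)
  have h1 : 𝔼 c : ι → α, F (fun a => c (e a)) =
      𝔼 x : ({i // p i} → α) × ({i // ¬ p i} → α), F (E' x.1) := by
    refine Fintype.expect_equiv E _ _ fun c => ?_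
    congr 1
  rw [h1, ← univ_product_univ, expect_product]
  have h2 : 𝔼 x : {i // p i} → α, F (E' x) = 𝔼 d : κ → α, F d :=
    Fintype.expect_equiv E' _ _ fun c => rfl
  rw [← h2]
  refine expect_congr rfl fun x _ => ?_
  exact expect_const (univ_nonempty (α := {i // ¬ p i} → α)) (F (E' x))

theorem expect_prod_rows (e : ρ → κ → ι) (he : Function.Injective fun x : ρ × κ => e x.1 x.2)
    (G : ρ → (κ → α) → ℝ) :
    𝔼 c : ι → α, ∏ i, G i (fun a => c (e i a)) = ∏ i, 𝔼 d : κ → α, G i d := by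
  classical
  rw [expect_comp_injective (fun x : ρ × κ => e x.1 x.2) he
    (fun d : ρ × κ → α => ∏ i, G i (fun a => d (i, a))), ← expect_prod_eq G]
  exact Fintype.expect_equiv (Equiv.curry ρ κ α) _ _ fun c => rfl

end Rows

section Cherry

variable {κ : Type*} [Fintype κ] [DecidableEq κ] {b : ℕ}

/-- The total weight of the coordinates with value `v`. -/
def wt (w : κ → ℝ) (v : Fin b) (d : κ → Fin b) : ℝ := ∑ a, if d a = v then w a else 0

/-- The total weight of pairs of distinct coordinates both having value `v`. -/
def wtPairs (w : κ → ℝ) (v : Fin b) (d : κ → Fin b) : ℝ :=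
  ∑ a, ∑ a', if a ≠ a' ∧ d a = v ∧ d a' = v then w a * w a' else 0

theorem wtPairs_nonneg {w : κ → ℝ} (hw : ∀ a, 0 ≤ w a) (v : Fin b) (d : κ → Fin b) :
    0 ≤ wtPairs w v d :=
  sum_nonneg fun a _ => sum_nonneg fun a' _ => by
    split_ifs
    · exact mul_nonneg (hw a) (hw a')
    · exact le_rfl

theorem wtPairs_le {w : κ → ℝ} (hw : ∀ a, 0 ≤ w a) (v : Fin b) (d : κ → Fin b) :
    wtPairs w v d ≤ wt w v d * wt w v d := by
  unfold wtPairs wt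
  rw [sum_mul_sum]
  refine sum_le_sum fun a _ => sum_le_sum fun a' _ => ?_
  have := mul_nonneg (hw a) (hw a')
  by_cases h1 : d a = v <;> by_cases h2 : d a' = v <;> by_cases h3 : a = a' <;> simp_all

variable [NeZero b]

theorem expect_exp_truncated_wtPairs_le {w : κ → ℝ} (hw : ∀ a, 0 ≤ w a) (v : Fin b)
    {l D k : ℝ} (hl : 0 ≤ l) (hD : 0 ≤ D) (hS : ∀ a, l * D * w a ≤ 1) (hk : ∑ a, w a ≤ k) :
    𝔼 d : κ → Fin b, Real.exp (l * if wt w v d ≤ D then wtPairs w v d else 0) ≤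
      Real.exp (9 * l * k ^ 2 * (1 / b) ^ 2 * Real.exp (2 * (1 / b) * (l * D) * k)) := by
  classical
  have hb : (0 : ℝ) < b := Nat.cast_pos.mpr (NeZero.pos b)
  have hk0 : 0 ≤ k := (sum_nonneg fun a _ => hw a).trans hk
  set m := l * D with hm
  have hm0 : 0 ≤ m := mul_nonneg hl hD
  set g : κ → κ → κ → Fin b → ℝ := fun a a' c u =>
    if u = v then Real.exp (m * w c) else if c = a ∨ c = a' then 0 else 1 with hg
  have hg0 : ∀ a a' c u, 0 ≤ g a a' c u := by
    intro a a' c u; simp only [hg]; split_ifs <;> positivity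
  have hexp : ∀ d : κ → Fin b, Real.exp (m * wt w v d) =
      ∏ c, if d c = v then Real.exp (m * w c) else 1 := by
    intro d
    rw [wt, mul_sum, Real.exp_sum]
    refine prod_congr rfl fun c _ => ?_
    split_ifs <;> simp
  have hpt : ∀ d : κ → Fin b, Real.exp (l * if wt w v d ≤ D then wtPairs w v d else 0) ≤
      1 + ∑ a, ∑ a', if a ≠ a' then l * (w a * w a') * ∏ c, g a a' c (d c) else 0 := by
    intro d
    split_ifs with hW
    · have hZ := wtPairs_nonneg hw v d
      have hW0 : 0 ≤ wt w v d := sum_nonneg fun a _ => by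
        split_ifs
        · exact hw a
        · exact le_rfl
      have h1 : l * wtPairs w v d ≤ m * wt w v d := by
        rw [hm, mul_assoc]
        refine mul_le_mul_of_nonneg_left ((wtPairs_le hw v d).trans ?_) hl
        exact mul_le_mul_of_nonneg_right hW hW0
      have h2 : Real.exp (l * wtPairs w v d) ≤
          1 + l * wtPairs w v d * Real.exp (l * wtPairs w v d) := by
        have := Real.add_one_le_exp (-(l * wtPairs w v d))
        have h3 := Real.exp_pos (l * wtPairs w v d)
        have h4 : Real.exp (l * wtPairs w v d) * Real.exp (-(l * wtPairs w v d)) = 1 := by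
          rw [← Real.exp_add]; simp
        nlinarith
      refine h2.trans ?_
      have h5 : l * wtPairs w v d * Real.exp (l * wtPairs w v d) ≤
          l * wtPairs w v d * Real.exp (m * wt w v d) := by gcongr
      have h6 : l * wtPairs w v d * Real.exp (m * wt w v d) ≤
          ∑ a, ∑ a', if a ≠ a' then l * (w a * w a') * ∏ c, g a a' c (d c) else 0 := by
        rw [wtPairs, mul_sum, sum_mul]
        refine sum_le_sum fun a _ => ?_
        rw [mul_sum, sum_mul]
        refine sum_le_sum fun a' _ => ?_
        by_cases h : a ≠ a' ∧ d a = v ∧ d a' = v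
        · rw [if_pos h, if_pos h.1, hexp]
          apply le_of_eq
          congr 1
          refine prod_congr rfl fun c _ => ?_
          simp only [hg]
          split_ifs with h7 h8
          · rfl
          · rcases h8 with rfl | rfl
            · exact absurd h.2.1 h7
            · exact absurd h.2.2 h7
          · rfl
        · rw [if_neg h]
          simp only [mul_zero, zero_mul]
          split_ifs
          · exact mul_nonneg (mul_nonneg hl (mul_nonneg (hw _) (hw _)))
              (prod_nonneg fun c _ => hg0 _ _ _ _)
          · exact le_rfl
      linarith
    · rw [mul_zero, Real.exp_zero]
      have : 0 ≤ ∑ a, ∑ a', if a ≠ a' then l * (w a * w a') * ∏ c, g a a' c (d c) else 0 :=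
        sum_nonneg fun a _ => sum_nonneg fun a' _ => by
          split_ifs
          · exact mul_nonneg (mul_nonneg hl (mul_nonneg (hw _) (hw _)))
              (prod_nonneg fun c _ => hg0 _ _ _ _)
          · exact le_rfl
      linarith
  have hprod : ∀ a a', a ≠ a' → 𝔼 d : κ → Fin b, ∏ c, g a a' c (d c) ≤
      9 * (1 / b) ^ 2 * Real.exp (2 * (1 / b) * m * k) := by
    intro a a' haa
    rw [expect_prod_eq]
    have hc : ∀ c, 𝔼 u, g a a' c u ≤
        (if c ∈ ({a, a'} : Finset κ) then 3 * (1 / b : ℝ) else 1) *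
          Real.exp (2 * (1 / b) * m * w c) := by
      intro c
      have hy0 : 0 ≤ m * w c := mul_nonneg hm0 (hw c)
      have hy : Real.exp (m * w c) - 1 ≤ 2 * (m * w c) := by
        have := Real.abs_exp_sub_one_le (x := m * w c) (by rw [abs_of_nonneg hy0]; exact hS c)
        rw [abs_of_nonneg hy0] at this
        exact (le_abs_self _).trans this
      simp only [hg]
      rw [expect_ite_eq]
      have h9 := Real.add_one_le_exp (2 * (1 / b) * m * w c)
      have hp : (0 : ℝ) < 1 / b := by positivity
      have h10 : 0 ≤ 2 * (1 / b) * m * w c := by have := hw c; positivity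
      have hS' := hS c
      split_ifs with h7 h8 h8
      · have : (1 / b : ℝ) * Real.exp (m * w c) ≤ (1 / b) * 3 := by gcongr; linarith
        have h11 : 3 * (1 / b : ℝ) ≤ 3 * (1 / b) * Real.exp (2 * (1 / b) * m * w c) :=
          le_mul_of_one_le_right (by positivity) (by linarith)
        linarith
      · simp at h8; tauto
      · simp at h8; tauto
      · have : (1 / b : ℝ) * (Real.exp (m * w c) - 1) ≤ (1 / b) * (2 * (m * w c)) := by gcongr
        nlinarith
    refine (prod_le_prod (fun c _ => expect_nonneg fun u _ => hg0 _ _ _ _)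
      fun c _ => hc c).trans ?_
    rw [prod_mul_distrib, prod_ite_mem, univ_inter, prod_const, card_pair haa, ← Real.exp_sum,
      ← mul_sum]
    have : (3 * (1 / b : ℝ)) ^ 2 = 9 * (1 / b) ^ 2 := by ring
    rw [this]
    gcongr
  calc _ ≤ 𝔼 d : κ → Fin b,
        (1 + ∑ a, ∑ a', if a ≠ a' then l * (w a * w a') * ∏ c, g a a' c (d c) else 0) :=
        expect_le_expect fun d _ => hpt d
    _ = 1 + ∑ a, ∑ a', if a ≠ a' then
          l * (w a * w a') * 𝔼 d : κ → Fin b, ∏ c, g a a' c (d c) else 0 := by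
        rw [expect_add_distrib, expect_const univ_nonempty, expect_sum_comm]
        congr 1
        refine sum_congr rfl fun a _ => ?_
        rw [expect_sum_comm]
        refine sum_congr rfl fun a' _ => ?_
        split_ifs
        · rw [mul_expect]
        · simp
    _ ≤ 1 + ∑ a, ∑ a', l * (w a * w a') *
          (9 * (1 / b) ^ 2 * Real.exp (2 * (1 / b) * m * k)) := by
        gcongr with a _ a' _
        have h0 : 0 ≤ l * (w a * w a') := mul_nonneg hl (mul_nonneg (hw _) (hw _))
        split_ifs with h
        · exact mul_le_mul_of_nonneg_left (hprod a a' h) h0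
        · positivity
    _ = 1 + l * (∑ a, w a) ^ 2 * (9 * (1 / b) ^ 2 * Real.exp (2 * (1 / b) * m * k)) := by
        rw [sq (∑ a, w a), sum_mul_sum, mul_sum, sum_mul]
        congr 1
        refine sum_congr rfl fun a _ => ?_
        rw [mul_sum, sum_mul]
    _ ≤ 1 + 9 * l * k ^ 2 * (1 / b) ^ 2 * Real.exp (2 * (1 / b) * m * k) := by
        have : l * (∑ a, w a) ^ 2 * (9 * (1 / b) ^ 2 * Real.exp (2 * (1 / b) * m * k)) ≤
            l * k ^ 2 * (9 * (1 / b) ^ 2 * Real.exp (2 * (1 / b) * m * k)) := by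
          gcongr
          exact sum_nonneg fun a _ => hw a
        linarith
    _ ≤ _ := by
        rw [add_comm]
        exact Real.add_one_le_exp _

end Cherry

section OutsideCherries

variable {r b : ℕ} [NeZero b]

theorem pr_outside_cherries (X : Finset (Fin r)) {w : Fin r → ℝ} (hw : ∀ a, 0 ≤ w a)
    {l D k T : ℝ} (hl : 0 ≤ l) (hD : 0 ≤ D) (hS : ∀ a, l * D * w a ≤ 1)
    (hk : ∑ a ∈ X, w a ≤ k) :
    pr (fun c : Sym2 (Fin r) → Fin b => T ≤ ∑ i : {i // i ∉ X},
      if wt (fun a : {a // a ∈ X} => w a) 0 (fun a : {a // a ∈ X} => c s(↑i, ↑a)) ≤ D then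
        wtPairs (fun a : {a // a ∈ X} => w a) 0 (fun a : {a // a ∈ X} => c s(↑i, ↑a)) else 0) ≤
      Real.exp (r * (9 * l * k ^ 2 * (1 / b) ^ 2 * Real.exp (2 * (1 / b) * (l * D) * k))
        - l * T) := by
  classical
  have hinj : Function.Injective
      fun x : {i // i ∉ X} × {a // a ∈ X} => s((x.1 : Fin r), (x.2 : Fin r)) := by
    rintro ⟨⟨i, hi⟩, ⟨a, ha⟩⟩ ⟨⟨i', hi'⟩, ⟨a', ha'⟩⟩ h
    simp only [Sym2.eq_iff] at h
    rcases h with ⟨rfl, rfl⟩ | ⟨rfl, rfl⟩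
    · rfl
    · exact absurd ha' hi
  set G : {i // i ∉ X} → ({a // a ∈ X} → Fin b) → ℝ := fun _ d =>
    Real.exp (l * if wt (fun a : {a // a ∈ X} => w a) 0 d ≤ D then
        wtPairs (fun a : {a // a ∈ X} => w a) 0 d else 0) with hG
  refine (pr_le_expect (F := fun c => (∏ i, G i (fun a => c s(↑i, ↑a))) * Real.exp (-(l * T)))
    (fun c => by positivity) fun c hc => ?_).trans ?_
  · rw [hG, ← Real.exp_sum, ← Real.exp_add, Real.one_le_exp_iff, ← mul_sum]
    nlinarith
  · rw [← expect_mul, expect_prod_rows _ hinj G, sub_eq_add_neg, Real.exp_add]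
    gcongr
    have hk' : ∑ a : {a // a ∈ X}, w a ≤ k := by
      rwa [← sum_coe_sort X] at hk
    have h0 := expect_exp_truncated_wtPairs_le (b := b) (w := fun a : {a // a ∈ X} => w a)
      (fun a => hw a) 0 hl hD (fun a => hS a) hk'
    refine (prod_le_prod (fun i _ => expect_nonneg fun d _ => (Real.exp_pos _).le)
      fun i _ => h0).trans ?_
    rw [prod_const, ← Real.exp_nat_mul]
    gcongr
    rw [card_univ]
    exact (Fintype.card_subtype_le _).trans (by simp)

end OutsideCherries

section

open scoped Classical

set_option linter.unusedSectionVars false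

section Base

variable {r b : ℕ} [NeZero b]

/-- The random base graph: the pairs coloured `0`. -/
def base (c : Sym2 (Fin r) → Fin b) : SimpleGraph (Fin r) where
  Adj i j := i ≠ j ∧ c s(i, j) = 0
  symm := ⟨fun i j h => ⟨h.1.symm, by rw [Sym2.eq_swap]; exact h.2⟩⟩
  loopless := ⟨fun _ h => h.1 rfl⟩

theorem base_adj {c : Sym2 (Fin r) → Fin b} {i j : Fin r} :
    (base c).Adj i j ↔ i ≠ j ∧ c s(i, j) = 0 := Iff.rfl

end Base

section Assignment

variable {V : Type*} [Fintype V] {r b : ℕ} [NeZero b]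
  (c : Sym2 (Fin r) → Fin b) (f : V → Fin r) (I : Finset V)

/-- The vertices of `I` whose part is adjacent to `i` in the base graph. -/
noncomputable def nb (i : Fin r) : Finset V := {u ∈ I | (base c).Adj (f u) i}

/-- The centres with more than `D` neighbours in `I`. -/
noncomputable def hi (D : ℕ) : Finset (Fin r) := {i | D < #(nb c f I i)}

theorem exists_assign (H : Finset (Fin r)) : ∃ φ : V → Option (Fin r),
    (∀ u, u ∉ I → φ u = none) ∧ (∀ u i, φ u = some i → i ∈ H ∧ u ∈ nb c f I i) ∧
      ∀ u ∈ I, φ u = none → ∀ i ∈ H, u ∉ nb c f I i := by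
  refine ⟨fun u => if h : ∃ i ∈ H, u ∈ nb c f I i then some h.choose else none, ?_, ?_, ?_⟩
  · intro u hu
    simp only [dite_eq_right_iff, reduceCtorEq, imp_false]
    rintro ⟨i, -, hi⟩
    exact hu (mem_filter.mp hi).1
  · intro u i h
    simp only at h
    split_ifs at h with h'
    · simp only [Option.some.injEq] at h
      exact h ▸ h'.choose_spec
  · intro u _ h i hi hu
    simp only [dite_eq_right_iff, reduceCtorEq, imp_false] at h
    exact h ⟨i, hi, hu⟩

/-- A map choosing, for each vertex of `I`, a centre in `H` adjacent to its part, if any. -/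
noncomputable def asg (H : Finset (Fin r)) : V → Option (Fin r) := (exists_assign c f I H).choose

theorem asg_eq_none (H : Finset (Fin r)) {u : V} (hu : u ∉ I) : asg c f I H u = none :=
  (exists_assign c f I H).choose_spec.1 u hu

theorem asg_eq_some {H : Finset (Fin r)} {u : V} {i : Fin r} (h : asg c f I H u = some i) :
    i ∈ H ∧ u ∈ nb c f I i :=
  (exists_assign c f I H).choose_spec.2.1 u i h

theorem asg_none {H : Finset (Fin r)} {u : V} (hu : u ∈ I) (h : asg c f I H u = none) :
    ∀ i ∈ H, u ∉ nb c f I i :=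
  (exists_assign c f I H).choose_spec.2.2 u hu h

/-- The codegrees of the base graph are at most `K`. -/
def CodegLe (K : ℕ) : Prop :=
  ∀ i j, i ≠ j → #{a | (base c).Adj a i ∧ (base c).Adj a j} ≤ K

/-- The parts have size at most `S`. -/
def PartsLe (S : ℕ) : Prop := ∀ a, #{u | f u = a} ≤ S

variable {c f I} {K S : ℕ}

theorem card_le_of_partsLe (hS : PartsLe f S) (A : Finset V) : #A ≤ S * #(A.image f) :=
  card_le_mul_card_image A S fun a _ =>
    (card_le_card (filter_subset_filter _ (subset_univ A))).trans (hS a)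

theorem card_nb_inter_le (hK : CodegLe c K) (hS : PartsLe f S) {i j : Fin r} (hij : i ≠ j) :
    #(nb c f I i ∩ nb c f I j) ≤ S * K := by
  refine (card_le_of_partsLe hS _).trans (Nat.mul_le_mul_left _ ?_)
  refine (card_le_card ?_).trans (hK i j hij)
  intro a ha
  obtain ⟨u, hu, rfl⟩ := mem_image.mp ha
  rw [mem_inter] at hu
  exact mem_filter.mpr ⟨mem_univ _, (mem_filter.mp hu.1).2, (mem_filter.mp hu.2).2⟩

theorem card_nb_sdiff_le (hK : CodegLe c K) (hS : PartsLe f S) (H : Finset (Fin r)) {i : Fin r}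
    (hi : i ∈ H) : #{u ∈ nb c f I i | asg c f I H u ≠ some i} ≤ #H * (S * K) := by
  have h1 : {u ∈ nb c f I i | asg c f I H u ≠ some i} ⊆
      (H.erase i).biUnion fun j => nb c f I i ∩ nb c f I j := by
    intro u hu
    rw [mem_filter] at hu
    rcases h : asg c f I H u with _ | j
    · exact absurd hu.1 (asg_none c f I (mem_filter.mp hu.1).1 h i hi)
    · obtain ⟨hj, hj'⟩ := asg_eq_some c f I h
      refine mem_biUnion.mpr ⟨j, mem_erase.mpr ⟨?_, hj⟩, mem_inter.mpr ⟨hu.1, hj'⟩⟩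
      rintro rfl
      exact hu.2 h
  calc _ ≤ _ := card_le_card h1
    _ ≤ ∑ j ∈ H.erase i, #(nb c f I i ∩ nb c f I j) := card_biUnion_le
    _ ≤ ∑ j ∈ H.erase i, S * K :=
        sum_le_sum fun j hj => card_nb_inter_le hK hS (ne_of_mem_erase hj).symm
    _ ≤ #H * (S * K) := by
        rw [sum_const, smul_eq_mul]
        exact Nat.mul_le_mul_right _ (card_le_card (erase_subset _ _))

theorem card_hi_le (hK : CodegLe c K) (hS : PartsLe f S) {D h : ℕ}
    (h1 : 2 * ((h + 1) * (S * K)) ≤ D) (h2 : 2 * #I < (h + 1) * D) : #(hi c f I D) ≤ h := by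
  by_contra! hlt
  obtain ⟨H, hH, hcard⟩ := exists_subset_card_eq (Nat.succ_le_of_lt hlt)
  have h3 : ∀ i ∈ H, D ≤ 2 * #{u ∈ I | asg c f I H u = some i} := by
    intro i hi
    have h4 : D < #(nb c f I i) := (mem_filter.mp (hH hi)).2
    have h5 := card_nb_sdiff_le (I := I) hK hS H hi
    rw [hcard] at h5
    have h6 := card_filter_add_card_filter_not (s := nb c f I i)
      (fun u => asg c f I H u = some i)
    have h7 : #{u ∈ nb c f I i | asg c f I H u = some i} ≤ #{u ∈ I | asg c f I H u = some i} :=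
      card_le_card (filter_subset_filter _ (filter_subset _ _))
    simp only [Nat.succ_eq_add_one, ne_eq] at h5
    omega
  have h4 : ∑ i ∈ H, #{u ∈ I | asg c f I H u = some i} ≤ #I := by
    rw [← card_biUnion]
    · exact card_le_card (biUnion_subset.mpr fun i _ => filter_subset _ _)
    · intro i _ j _ hij
      rw [Function.onFun, disjoint_left]
      intro u hu hu'
      rw [mem_filter] at hu hu'
      exact hij (Option.some.inj (hu.2.symm.trans hu'.2))
  have h5 := sum_le_sum h3
  rw [sum_const, smul_eq_mul, hcard, ← mul_sum] at h5
  simp only [Nat.succ_eq_add_one] at h5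
  omega

end Assignment

section Leftover

variable {V : Type*} [Fintype V] {r b : ℕ} [NeZero b]
  (c : Sym2 (Fin r) → Fin b) (f : V → Fin r) (I : Finset V)

/-- Two vertices are closed if their parts have a common neighbour in the base graph. -/
def Cl (u v : V) : Prop := ∃ i, (base c).Adj (f u) i ∧ (base c).Adj (f v) i

/-- Closed pairs which are not accounted for by the centres of high degree. -/
def Left (D : ℕ) (u v : V) : Prop :=
  Cl c f u v ∧ ¬ ∃ i, asg c f I (hi c f I D) u = some i ∧ asg c f I (hi c f I D) v = some i

/-- The number of vertices of `I` in a part. -/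
noncomputable def load (a : Fin r) : ℝ := #{u ∈ I | f u = a}

/-- The number of pairs closed by a centre of low degree outside the footprint of `I`. -/
noncomputable def outsideSum (D : ℕ) : ℝ := ∑ i : {i // i ∉ I.image f},
  if wt (fun a : {a // a ∈ I.image f} => load f I a) 0 (fun a => c s(↑i, ↑a)) ≤ D then
    wtPairs (fun a : {a // a ∈ I.image f} => load f I a) 0 (fun a => c s(↑i, ↑a)) else 0

variable {c f I}

theorem wt_load_eq {i : Fin r} (hi : i ∉ I.image f) :
    wt (fun a : {a // a ∈ I.image f} => load f I a) 0 (fun a => c s(i, ↑a)) = #(nb c f I i) := by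
  have h1 := card_eq_sum_card_fiberwise (f := f) (s := nb c f I i) (t := I.image f)
    (fun u hu => by
      simp only [nb, coe_filter, Set.mem_ofPred_eq] at hu
      exact mem_coe.mpr (mem_image_of_mem f hu.1))
  rw [h1, wt, Nat.cast_sum, ← sum_coe_sort (I.image f)]
  refine sum_congr rfl fun a _ => ?_
  have hia : (a : Fin r) ≠ i := fun h => hi (h ▸ a.2)
  split_ifs with h
  · rw [load]
    congr 2
    ext u
    simp only [nb, mem_filter, base_adj]
    constructor
    · rintro ⟨hu, hua⟩
      rw [hua, Sym2.eq_swap]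
      exact ⟨⟨hu, hia, h⟩, rfl⟩
    · rintro ⟨⟨hu, -⟩, hua⟩
      exact ⟨hu, hua⟩
  · rw [eq_comm, Nat.cast_eq_zero, card_eq_zero, filter_eq_empty_iff]
    intro u hu hua
    simp only [nb, mem_filter, base_adj] at hu
    rw [hua, Sym2.eq_swap] at hu
    exact h hu.2.2

theorem card_pairs_le_wtPairs {i : Fin r} (hi : i ∉ I.image f) :
    (#{x ∈ nb c f I i ×ˢ nb c f I i | f x.1 ≠ f x.2} : ℝ) ≤
      wtPairs (fun a : {a // a ∈ I.image f} => load f I a) 0 (fun a => c s(i, ↑a)) := by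
  set P := {x ∈ nb c f I i ×ˢ nb c f I i | f x.1 ≠ f x.2} with hP
  have h1 := card_eq_sum_card_fiberwise (f := fun x : V × V => (f x.1, f x.2)) (s := P)
    (t := I.image f ×ˢ I.image f) (fun x hx => by
      simp only [hP, nb, coe_filter, Set.mem_ofPred_eq, mem_product, mem_filter] at hx
      exact mem_coe.mpr (mem_product.mpr
        ⟨mem_image_of_mem f hx.1.1.1, mem_image_of_mem f hx.1.2.1⟩))
  rw [h1, sum_product, wtPairs, Nat.cast_sum, ← sum_coe_sort (I.image f)]
  refine sum_le_sum fun a _ => ?_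
  rw [Nat.cast_sum, ← sum_coe_sort (I.image f)]
  refine sum_le_sum fun a' _ => ?_
  have hia : (a : Fin r) ≠ i := fun h => hi (h ▸ a.2)
  have hia' : (a' : Fin r) ≠ i := fun h => hi (h ▸ a'.2)
  split_ifs with h
  · rw [load, load, ← Nat.cast_mul, ← card_product, Nat.cast_le]
    refine card_le_card fun x hx => ?_
    simp only [hP, nb, mem_filter, mem_product, Prod.mk.injEq] at hx ⊢
    exact ⟨⟨hx.1.1.1.1, hx.2.1⟩, ⟨hx.1.1.2.1, hx.2.2⟩⟩
  · rw [← Nat.cast_zero, Nat.cast_le, Nat.le_zero, card_eq_zero, filter_eq_empty_iff]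
    intro x hx hxa
    simp only [hP, nb, mem_filter, mem_product, base_adj] at hx
    simp only [Prod.mk.injEq] at hxa
    refine h ⟨fun haa => hx.2 (by rw [hxa.1, hxa.2, haa]), ?_, ?_⟩
    · rw [Sym2.eq_swap, ← hxa.1]; exact hx.1.1.2.2
    · rw [Sym2.eq_swap, ← hxa.2]; exact hx.1.2.2.2

/-- The pairs of distinct elements of `X`, unordered. -/
noncomputable def edgesIn (X : Finset (Fin r)) : Finset (Sym2 (Fin r)) :=
  X.offDiag.image Sym2.mk.uncurry

theorem card_offDiag_filter_le {r : ℕ} (A : Finset (Fin r × Fin r)) :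
    #A ≤ 2 * #(A.image Sym2.mk.uncurry) := by
  refine card_le_mul_card_image A 2 fun e _ => ?_
  induction e using Sym2.inductionOn with
  | hf i j =>
    refine (card_le_card (t := {(i, j), (j, i)}) fun x hx => ?_).trans card_le_two
    simp only [mem_filter] at hx
    have := hx.2
    rcases x with ⟨x, y⟩
    simp only [Function.uncurry, Sym2.eq_iff] at this
    simp only [mem_insert, mem_singleton, Prod.mk.injEq]
    exact this

theorem sum_card_nb_inside_le {S : ℕ} (hS : PartsLe f S) :
    ∑ i ∈ I.image f, #(nb c f I i) ≤ S * (2 * #{e ∈ edgesIn (I.image f) | c e = 0}) := by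
  set X := I.image f with hX
  have h1 : ∀ i ∈ X, #(nb c f I i) ≤ S * #((nb c f I i).image f) :=
    fun i _ => card_le_of_partsLe hS _
  refine (sum_le_sum h1).trans ?_
  rw [← mul_sum]
  refine Nat.mul_le_mul_left _ ?_
  have h2 : ∑ i ∈ X, #((nb c f I i).image f) = #(X.sigma fun i => (nb c f I i).image f) :=
    (card_sigma _ _).symm
  have h3 : #(X.sigma fun i => (nb c f I i).image f) ≤
      #{x ∈ X.offDiag | c s(x.1, x.2) = 0} := by
    refine card_le_card_of_injOn (fun x => (x.1, x.2)) ?_ ?_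
    · rintro ⟨i, a⟩ hx
      simp only [coe_sigma, Set.mem_sigma_iff, mem_coe, mem_image, nb, mem_filter, base_adj] at hx
      obtain ⟨hi, u, ⟨hu, hne, hc⟩, rfl⟩ := hx
      simp only [coe_filter, mem_offDiag, Set.mem_ofPred_eq]
      exact ⟨⟨hi, mem_image_of_mem f hu, hne.symm⟩, by rw [Sym2.eq_swap]; exact hc⟩
    · rintro ⟨i, a⟩ _ ⟨j, a'⟩ _ h
      simp only [Prod.mk.injEq] at h
      obtain ⟨rfl, rfl⟩ := h
      rfl
  rw [h2]
  refine h3.trans ((card_offDiag_filter_le _).trans (Nat.mul_le_mul_left _ (card_le_card ?_)))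
  intro e he
  obtain ⟨x, hx, rfl⟩ := mem_image.mp he
  rw [mem_filter] at hx ⊢
  exact ⟨mem_image_of_mem _ hx.1, hx.2⟩

theorem card_left_le {K S D h e₁ : ℕ} {T : ℝ} (hK : CodegLe c K) (hS : PartsLe f S)
    (hh : #(hi c f I D) ≤ h) (hout : outsideSum c f I D ≤ T)
    (he : #{e ∈ edgesIn (I.image f) | c e = 0} ≤ e₁) :
    (#{x ∈ I ×ˢ I | Left c f I D x.1 x.2} : ℝ) ≤
      #I * S + T + D * (S * (2 * e₁)) + h * (2 * #I * (h * (S * K))) := by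
  set X := I.image f with hX
  set H := hi c f I D with hH
  set P₁ := {x ∈ I ×ˢ I | f x.1 = f x.2} with hP₁
  set P₂ := ({i | i ∉ X ∧ i ∉ H} : Finset (Fin r)).biUnion fun i =>
    {x ∈ nb c f I i ×ˢ nb c f I i | f x.1 ≠ f x.2} with hP₂
  set P₃ := ({i ∈ X | i ∉ H} : Finset (Fin r)).biUnion fun i =>
    nb c f I i ×ˢ nb c f I i with hP₃
  set P₄ := H.biUnion fun i => ({u ∈ nb c f I i | asg c f I H u ≠ some i} ×ˢ I) ∪
    (I ×ˢ {u ∈ nb c f I i | asg c f I H u ≠ some i}) with hP₄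
  have hsub : {x ∈ I ×ˢ I | Left c f I D x.1 x.2} ⊆ P₁ ∪ P₂ ∪ P₃ ∪ P₄ := by
    rintro ⟨u, v⟩ hx
    simp only [mem_filter, mem_product] at hx
    obtain ⟨⟨hu, hv⟩, ⟨i, hui, hvi⟩, hne⟩ := hx
    have hu' : u ∈ nb c f I i := mem_filter.mpr ⟨hu, hui⟩
    have hv' : v ∈ nb c f I i := mem_filter.mpr ⟨hv, hvi⟩
    simp only [mem_union]
    by_cases hiH : i ∈ H
    · right
      refine mem_biUnion.mpr ⟨i, hiH, ?_⟩
      simp only [mem_union, mem_product, mem_filter]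
      by_cases h1 : asg c f I H u = some i
      · exact Or.inr ⟨hu, hv', fun h2 => hne ⟨i, h1, h2⟩⟩
      · exact Or.inl ⟨⟨hu', h1⟩, hv⟩
    · left
      by_cases hiX : i ∈ X
      · right
        exact mem_biUnion.mpr ⟨i, mem_filter.mpr ⟨hiX, hiH⟩, mem_product.mpr ⟨hu', hv'⟩⟩
      · left
        by_cases hf : f u = f v
        · exact Or.inl (mem_filter.mpr ⟨mem_product.mpr ⟨hu, hv⟩, hf⟩)
        · exact Or.inr (mem_biUnion.mpr ⟨i, mem_filter.mpr ⟨mem_univ _, hiX, hiH⟩,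
            mem_filter.mpr ⟨mem_product.mpr ⟨hu', hv'⟩, hf⟩⟩)
  have hlow : ∀ i, i ∉ H → #(nb c f I i) ≤ D := by
    intro i hi
    by_contra! h
    exact hi (mem_filter.mpr ⟨mem_univ _, h⟩)
  have c₁ : #P₁ ≤ #I * S := by
    have : #P₁ = ∑ u ∈ I, #{v ∈ I | f u = f v} := by
      rw [hP₁, card_filter, sum_product]
      exact sum_congr rfl fun u _ => (card_filter _ _).symm
    rw [this, ← smul_eq_mul, ← sum_const]
    refine sum_le_sum fun u _ => (card_le_card fun v hv => ?_).trans (hS (f u))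
    exact mem_filter.mpr ⟨mem_univ _, (mem_filter.mp hv).2.symm⟩
  have c₂ : (#P₂ : ℝ) ≤ T := by
    refine le_trans ?_ hout
    calc (#P₂ : ℝ) ≤ ∑ i ∈ ({i | i ∉ X ∧ i ∉ H} : Finset (Fin r)),
          (#{x ∈ nb c f I i ×ˢ nb c f I i | f x.1 ≠ f x.2} : ℝ) := by
          rw [← Nat.cast_sum, Nat.cast_le]
          exact card_biUnion_le
      _ = ∑ i ∈ ({i | i ∉ X} : Finset (Fin r)), if i ∉ H then
          (#{x ∈ nb c f I i ×ˢ nb c f I i | f x.1 ≠ f x.2} : ℝ) else 0 := by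
          rw [← sum_filter, filter_filter]
      _ = ∑ i : {i // i ∉ X}, if (i : Fin r) ∉ H then
          (#{x ∈ nb c f I i ×ˢ nb c f I i | f x.1 ≠ f x.2} : ℝ) else 0 := by
          refine sum_subtype _ (fun i => by simp) _
      _ ≤ _ := by
          rw [outsideSum]
          refine sum_le_sum fun i _ => ?_
          have hpos := wtPairs_nonneg (b := b) (w := fun a : {a // a ∈ I.image f} => load f I a)
            (fun a => Nat.cast_nonneg _) 0 (fun a => c s(↑i, ↑a))
          by_cases hiH : (i : Fin r) ∈ H
          · rw [if_neg (not_not.mpr hiH)]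
            split_ifs
            · exact hpos
            · exact le_rfl
          · rw [if_pos hiH, if_pos]
            · exact card_pairs_le_wtPairs i.2
            · rw [wt_load_eq i.2]
              exact Nat.cast_le.mpr (hlow i hiH)
  have c₃ : #P₃ ≤ D * (S * (2 * e₁)) := by
    calc #P₃ ≤ ∑ i ∈ X with i ∉ H, #(nb c f I i ×ˢ nb c f I i) := card_biUnion_le
      _ ≤ ∑ i ∈ X with i ∉ H, D * #(nb c f I i) := by
          refine sum_le_sum fun i hi => ?_
          rw [card_product]
          exact Nat.mul_le_mul_right _ (hlow i (mem_filter.mp hi).2)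
      _ ≤ ∑ i ∈ X, D * #(nb c f I i) :=
          sum_le_sum_of_subset (filter_subset _ _)
      _ ≤ D * (S * (2 * e₁)) := by
          rw [← mul_sum]
          refine Nat.mul_le_mul_left _ ((sum_card_nb_inside_le hS).trans ?_)
          gcongr
  have c₄ : #P₄ ≤ h * (2 * #I * (h * (S * K))) := by
    calc #P₄ ≤ ∑ i ∈ H, _ := card_biUnion_le
      _ ≤ ∑ i ∈ H, 2 * #I * (h * (S * K)) := by
          refine sum_le_sum fun i hi => (card_union_le _ _).trans ?_
          rw [card_product, card_product]
          have h1 := (card_nb_sdiff_le (I := I) hK hS H hi).trans (Nat.mul_le_mul_right _ hh)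
          nlinarith [Nat.mul_le_mul_left (#I) h1]
      _ ≤ _ := by
          rw [sum_const, smul_eq_mul]
          exact Nat.mul_le_mul_right _ hh
  have c₀ := card_le_card hsub
  have c₅ : #(P₁ ∪ P₂ ∪ P₃ ∪ P₄) ≤ #P₁ + #P₂ + #P₃ + #P₄ := by
    have := card_union_le (P₁ ∪ P₂ ∪ P₃) P₄
    have := card_union_le (P₁ ∪ P₂) P₃
    have := card_union_le P₁ P₂
    omega
  have d₀ : (#{x ∈ I ×ˢ I | Left c f I D x.1 x.2} : ℝ) ≤ #P₁ + #P₂ + #P₃ + #P₄ := by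
    exact_mod_cast c₀.trans c₅
  have d₁ : (#P₁ : ℝ) ≤ #I * S := by exact_mod_cast c₁
  have d₃ : (#P₃ : ℝ) ≤ D * (S * (2 * e₁)) := by exact_mod_cast c₃
  have d₄ : (#P₄ : ℝ) ≤ h * (2 * #I * (h * (S * K))) := by exact_mod_cast c₄
  linarith

end Leftover

section Packing

variable {r b : ℕ} [NeZero b] (c : Sym2 (Fin r) → Fin b)

/-- A family of pairwise edge-disjoint triangles of the base graph. -/
def IsPacking (F : Finset (Finset (Fin r))) : Prop :=
  (∀ t ∈ F, (base c).IsNClique 3 t) ∧ ∀ s ∈ F, ∀ t ∈ F, s ≠ t → #(s ∩ t) ≤ 1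

theorem exists_maximal_packing : ∃ F, IsPacking c F ∧
    ∀ t, (base c).IsNClique 3 t → ∃ s ∈ F, 2 ≤ #(s ∩ t) := by
  obtain ⟨F, hF, hmax⟩ := exists_max_image ({F | IsPacking c F} : Finset _) card
    ⟨∅, mem_filter.mpr ⟨mem_univ _, by simp [IsPacking]⟩⟩
  simp only [mem_filter, mem_univ, true_and] at hF hmax
  refine ⟨F, hF, fun t ht => ?_⟩
  by_contra! hlt
  have htF : t ∉ F := fun h => by
    have := hlt t h
    rw [inter_self, ht.card_eq] at this
    omega
  have h1 : IsPacking c (insert t F) := by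
    refine ⟨fun s hs => ?_, fun s hs s' hs' hne => ?_⟩
    · rcases mem_insert.mp hs with rfl | hs
      · exact ht
      · exact hF.1 s hs
    · rcases mem_insert.mp hs with h | h <;> rcases mem_insert.mp hs' with h' | h'
      · exact absurd (h.trans h'.symm) hne
      · rw [inter_comm, h]
        exact Nat.le_of_lt_succ (hlt s' h')
      · rw [h']
        exact Nat.le_of_lt_succ (hlt s h)
      · exact hF.2 s h s' h' hne
  have := hmax _ h1
  rw [card_insert_of_notMem htF] at this
  omega

/-- A maximal family of edge-disjoint triangles of the base graph. -/
noncomputable def packing : Finset (Finset (Fin r)) := (exists_maximal_packing c).choose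

theorem packing_isPacking : IsPacking c (packing c) := (exists_maximal_packing c).choose_spec.1

theorem packing_maximal {t : Finset (Fin r)} (ht : (base c).IsNClique 3 t) :
    ∃ s ∈ packing c, 2 ≤ #(s ∩ t) := (exists_maximal_packing c).choose_spec.2 t ht

/-- The base graph without the edges of the chosen triangles. -/
def thin : SimpleGraph (Fin r) where
  Adj i j := (base c).Adj i j ∧ ¬ ∃ t ∈ packing c, i ∈ t ∧ j ∈ t
  symm := ⟨fun _ _ h => ⟨h.1.symm, fun ⟨t, ht, hj, hi⟩ => h.2 ⟨t, ht, hi, hj⟩⟩⟩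
  loopless := ⟨fun _ h => h.1.ne rfl⟩

variable {c}

theorem thin_adj {i j : Fin r} : (thin c).Adj i j ↔
    (base c).Adj i j ∧ ¬ ∃ t ∈ packing c, i ∈ t ∧ j ∈ t := Iff.rfl

theorem thin_no_triangle {i j k : Fin r} (hij : (thin c).Adj i j) (hik : (thin c).Adj i k)
    (hjk : (thin c).Adj j k) : False := by
  have ht : (base c).IsNClique 3 {i, j, k} :=
    SimpleGraph.is3Clique_triple_iff.mpr ⟨hij.1, hik.1, hjk.1⟩
  obtain ⟨s, hs, hcard⟩ := packing_maximal c ht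
  obtain ⟨x, hx, y, hy, hxy⟩ := one_lt_card.mp hcard
  have h1 : (thin c).Adj x y := by
    simp only [mem_inter, mem_insert, mem_singleton] at hx hy
    rcases hx.2 with rfl | rfl | rfl <;> rcases hy.2 with rfl | rfl | rfl <;>
      first | exact absurd rfl hxy | assumption | (apply SimpleGraph.Adj.symm; assumption)
  exact h1.2 ⟨s, hs, (mem_inter.mp hx).1, (mem_inter.mp hy).1⟩

end Packing

section Graph

variable {V : Type*} {r b : ℕ} [NeZero b] (c c' : Sym2 (Fin r) → Fin b) (f g : V → Fin r)

theorem Cl.symm {c : Sym2 (Fin r) → Fin b} {f : V → Fin r} {u v : V} (h : Cl c f u v) :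
    Cl c f v u := h.imp fun _ h => h.symm

/-- The edges of one colour: lifted edges of the thinned base graph which are not closed in the
other colour. -/
def Bite (u v : V) : Prop := (thin c).Adj (f u) (f v) ∧ ¬ Cl c' g u v

/-- The graph built from the two bites. -/
def biteGraph : SimpleGraph V where
  Adj u v := Bite c c' f g u v ∨ Bite c' c g f u v
  symm := ⟨fun _ _ h => h.imp (fun h => ⟨h.1.symm, fun h' => h.2 h'.symm⟩)
    (fun h => ⟨h.1.symm, fun h' => h.2 h'.symm⟩)⟩
  loopless := ⟨fun _ h => h.elim (fun h => h.1.ne rfl) fun h => h.1.ne rfl⟩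

variable {c c' f g}

theorem Bite.cl {u v w : V} (h : Bite c c' f g u w) (h' : Bite c c' f g v w) : Cl c f u v :=
  ⟨f w, h.1.1, h'.1.1⟩

theorem Bite.symm {u v : V} (h : Bite c c' f g u v) : Bite c c' f g v u :=
  ⟨h.1.symm, fun h' => h.2 h'.symm⟩

theorem biteGraph_cliqueFree : (biteGraph c c' f g).CliqueFree 3 := by
  intro t ht
  obtain ⟨x, y, z, hxy, hxz, hyz, -⟩ := SimpleGraph.is3Clique_iff.mp ht
  rcases hxy with h1 | h1 <;> rcases hxz with h2 | h2 <;> rcases hyz with h3 | h3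
  · exact thin_no_triangle h1.1 h2.1 h3.1
  · exact h3.2 (h1.symm.cl h2.symm)
  · exact h2.2 (h1.cl h3.symm)
  · exact h1.2 (h2.cl h3)
  · exact h1.2 (h2.cl h3)
  · exact h2.2 (h1.cl h3.symm)
  · exact h3.2 (h1.symm.cl h2.symm)
  · exact thin_no_triangle h1.1 h2.1 h3.1

end Graph

section Exposed

variable {V : Type*} [Fintype V] [Nonempty V] {r b : ℕ} [NeZero b]
  (c c' : Sym2 (Fin r) → Fin b) (f g : V → Fin r) (I : Finset V)

/-- A representative in `I` of each part meeting `I`. -/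
noncomputable def rep : Fin r → V := Function.invFunOn f I

variable {f I} in
theorem rep_mem {a : Fin r} (ha : a ∈ I.image f) : rep f I a ∈ I := by
  obtain ⟨u, hu, h⟩ := mem_image.mp ha
  exact mem_coe.mp (Function.invFunOn_mem ⟨u, mem_coe.mpr hu, h⟩)

variable {f I} in
theorem apply_rep {a : Fin r} (ha : a ∈ I.image f) : f (rep f I a) = a := by
  obtain ⟨u, hu, h⟩ := mem_image.mp ha
  exact Function.invFunOn_eq ⟨u, mem_coe.mpr hu, h⟩

theorem rep_injOn : Set.InjOn (rep f I) (I.image f : Finset (Fin r)) := fun a ha a' ha' h => by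
  rw [← apply_rep (mem_coe.mp ha), h, apply_rep (mem_coe.mp ha')]

/-- The pairs which have to be present. -/
noncomputable def sset (H : Finset (Fin r)) (φ : V → Option (Fin r)) : Finset (Sym2 (Fin r)) :=
  {x ∈ I.image f ×ˢ H | x.1 ∉ H ∧ ∃ u ∈ I, f u = x.1 ∧ φ u = some x.2}.image Sym2.mk.uncurry

/-- The pairs most of which have to be absent. -/
noncomputable def nset (H : Finset (Fin r)) (ψ : V → Option (Fin r)) : Finset (Sym2 (Fin r)) :=
  {x ∈ (I.image f \ H).offDiag | ¬ ∃ j, ψ (rep f I x.1) = some j ∧ ψ (rep f I x.2) = some j}.image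
    Sym2.mk.uncurry

/-- The pairs closed in the other colour for an exceptional reason. -/
noncomputable def ebad (D : ℕ) : Finset (Sym2 (Fin r)) :=
  {x ∈ (I.image f).offDiag | Left c' g I D (rep f I x.1) (rep f I x.2)}.image Sym2.mk.uncurry

theorem card_ebad_le (D : ℕ) :
    #(ebad c' f g I D) ≤ #{x ∈ I ×ˢ I | Left c' g I D x.1 x.2} := by
  refine card_image_le.trans (card_le_card_of_injOn (fun x => (rep f I x.1, rep f I x.2)) ?_ ?_)
  · intro x hx
    simp only [coe_filter, mem_offDiag, Set.mem_ofPred_eq, mem_product] at hx ⊢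
    exact ⟨⟨rep_mem hx.1.1, rep_mem hx.1.2.1⟩, hx.2⟩
  · intro x hx y hy h
    simp only [coe_filter, mem_offDiag, Set.mem_ofPred_eq] at hx hy
    simp only [Prod.mk.injEq] at h
    exact Prod.ext (rep_injOn f I (mem_coe.mpr hx.1.1) (mem_coe.mpr hy.1.1) h.1)
      (rep_injOn f I (mem_coe.mpr hx.1.2.1) (mem_coe.mpr hy.1.2.1) h.2)

theorem disjoint_sset_nset (H : Finset (Fin r)) (φ ψ : V → Option (Fin r)) :
    Disjoint (sset f I H φ) (nset f I H ψ) := by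
  rw [disjoint_left]
  intro e he he'
  obtain ⟨x, hx, rfl⟩ := mem_image.mp he
  obtain ⟨y, hy, hxy⟩ := mem_image.mp he'
  simp only [mem_filter, mem_product, mem_offDiag, mem_sdiff] at hx hy
  simp only [Function.uncurry, Sym2.eq_iff] at hxy
  rcases hxy with ⟨-, h⟩ | ⟨h, -⟩
  · exact hy.1.2.1.2 (h ▸ hx.1.2)
  · exact hy.1.1.2 (h ▸ hx.1.2)

theorem sum_card_image_le_card_sset (H : Finset (Fin r)) (φ : V → Option (Fin r)) :
    ∑ i ∈ H, #({u ∈ I | φ u = some i}.image f) ≤ #(sset f I H φ) + #H * #H := by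
  have h1 : ∀ i ∈ H, #({u ∈ I | φ u = some i}.image f) ≤
      #({u ∈ I | φ u = some i}.image f \ H) + #H := fun i _ => by
    have := le_card_sdiff H ({u ∈ I | φ u = some i}.image f)
    omega
  refine (sum_le_sum h1).trans ?_
  rw [sum_add_distrib, sum_const, smul_eq_mul, ← card_sigma]
  refine Nat.add_le_add_right (card_le_card_of_injOn (fun x => s(x.2, x.1)) ?_ ?_) _
  · rintro ⟨i, a⟩ hx
    simp only [coe_sigma, Set.mem_sigma_iff, mem_coe, mem_sdiff, mem_image, mem_filter] at hx
    obtain ⟨hi, ⟨u, ⟨hu, hui⟩, rfl⟩, ha⟩ := hx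
    exact mem_coe.mpr (mem_image.mpr ⟨(f u, i), mem_filter.mpr ⟨mem_product.mpr
      ⟨mem_image_of_mem f hu, hi⟩, ha, u, hu, rfl, hui⟩, rfl⟩)
  · rintro ⟨i, a⟩ hx ⟨j, a'⟩ hx' h
    simp only [coe_sigma, Set.mem_sigma_iff, mem_coe, mem_sdiff] at hx hx'
    simp only [Sym2.eq_iff] at h
    rcases h with ⟨rfl, rfl⟩ | ⟨h, -⟩
    · rfl
    · exact absurd (h ▸ hx'.1) hx.2.2

theorem card_nset_ge (H H' : Finset (Fin r)) {ψ : V → Option (Fin r)}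
    (hψ : ∀ u i, ψ u = some i → i ∈ H') {h : ℕ} (hH : #H ≤ h) :
    (#(I.image f) : ℝ) ^ 2 - (2 * h + 1) * #(I.image f)
      - ∑ j ∈ H', (#{u ∈ I | ψ u = some j} : ℝ) ^ 2 ≤ 2 * #(nset f I H ψ) := by
  set X := I.image f with hX
  set P := {x ∈ (X \ H).offDiag |
    ∃ j, ψ (rep f I x.1) = some j ∧ ψ (rep f I x.2) = some j} with hP
  set Q := {x ∈ (X \ H).offDiag |
    ¬ ∃ j, ψ (rep f I x.1) = some j ∧ ψ (rep f I x.2) = some j} with hQ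
  have h1 : #P + #Q = #(X \ H).offDiag := card_filter_add_card_filter_not _
  have h2 : #Q ≤ 2 * #(nset f I H ψ) := card_offDiag_filter_le Q
  have h3 : #P ≤ ∑ j ∈ H', #{u ∈ I | ψ u = some j} ^ 2 := by
    calc #P ≤ #(H'.biUnion fun j => {u ∈ I | ψ u = some j} ×ˢ {u ∈ I | ψ u = some j}) := by
          refine card_le_card_of_injOn (fun x => (rep f I x.1, rep f I x.2)) ?_ ?_
          · intro x hx
            simp only [hP, coe_filter, mem_offDiag, mem_sdiff, Set.mem_ofPred_eq] at hx
            obtain ⟨j, hj, hj'⟩ := hx.2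
            exact mem_coe.mpr (mem_biUnion.mpr ⟨j, hψ _ _ hj, mem_product.mpr
              ⟨mem_filter.mpr ⟨rep_mem hx.1.1.1, hj⟩, mem_filter.mpr ⟨rep_mem hx.1.2.1.1, hj'⟩⟩⟩)
          · intro x hx y hy h
            simp only [hP, coe_filter, mem_offDiag, mem_sdiff, Set.mem_ofPred_eq] at hx hy
            simp only [Prod.mk.injEq] at h
            exact Prod.ext (rep_injOn f I (mem_coe.mpr hx.1.1.1) (mem_coe.mpr hy.1.1.1) h.1)
              (rep_injOn f I (mem_coe.mpr hx.1.2.1.1) (mem_coe.mpr hy.1.2.1.1) h.2)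
      _ ≤ ∑ j ∈ H', _ := card_biUnion_le
      _ = _ := sum_congr rfl fun j _ => by rw [card_product, sq]
  have h4 : (#(X \ H).offDiag : ℝ) = (#(X \ H) : ℝ) ^ 2 - #(X \ H) := by
    rw [offDiag_card, Nat.cast_sub (Nat.le_mul_self _)]
    push_cast
    ring
  have h5 : (#X : ℝ) - h ≤ #(X \ H) := by
    have := le_card_sdiff H X
    rw [sub_le_iff_le_add]
    exact_mod_cast (by omega : #X ≤ #(X \ H) + h)
  have h6 : (#P : ℝ) ≤ ∑ j ∈ H', (#{u ∈ I | ψ u = some j} : ℝ) ^ 2 := by exact_mod_cast h3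
  have h7 : (#P : ℝ) + #Q = #(X \ H).offDiag := by exact_mod_cast h1
  have h8 : (#Q : ℝ) ≤ 2 * #(nset f I H ψ) := by exact_mod_cast h2
  have h9 : (#X : ℝ) ^ 2 - (2 * h + 1) * #X ≤ (#(X \ H) : ℝ) ^ 2 - #(X \ H) := by
    have hm : (0 : ℝ) ≤ (#(X \ H) : ℝ) ^ 2 - #(X \ H) := h4 ▸ Nat.cast_nonneg _
    have hx0 : (0 : ℝ) ≤ #X := Nat.cast_nonneg _
    have hh0 : (0 : ℝ) ≤ h := Nat.cast_nonneg _
    rcases le_or_gt #X h with hle | hlt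
    · have : (#X : ℝ) ≤ h := by exact_mod_cast hle
      nlinarith
    · have : (h : ℝ) + 1 ≤ #X := by exact_mod_cast hlt
      nlinarith
  linarith

theorem card_image_le_structural (H : Finset (Fin r)) (φ : V → Option (Fin r)) :
    #(I.image f) + ∑ i ∈ H, #{u ∈ I | φ u = some i} ≤
      ∑ i ∈ H, #({u ∈ I | φ u = some i}.image f) + #I := by
  set A := H.biUnion fun i => {u ∈ I | φ u = some i} with hA
  have h1 : #A = ∑ i ∈ H, #{u ∈ I | φ u = some i} := by
    refine card_biUnion fun i _ j _ hij => ?_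
    rw [Function.onFun, disjoint_left]
    intro u hu hu'
    rw [mem_filter] at hu hu'
    exact hij (Option.some.inj (hu.2.symm.trans hu'.2))
  have hAI : A ⊆ I := biUnion_subset.mpr fun i _ => filter_subset _ _
  have h2 : #(A.image f) ≤ ∑ i ∈ H, #({u ∈ I | φ u = some i}.image f) := by
    rw [hA, biUnion_image]
    exact card_biUnion_le
  have h3 : #(I.image f) ≤ #(A.image f) + #((I \ A).image f) := by
    refine (card_le_card ?_).trans (card_union_le _ _)
    rw [← image_union, union_sdiff_of_subset hAI]
  have h4 : #((I \ A).image f) ≤ #(I \ A) := card_image_le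
  have h5 := card_sdiff_add_card_eq_card hAI
  omega

/-- The event whose probability decides the argument. -/
def Exposed (H : Finset (Fin r)) (φ ψ : V → Option (Fin r)) (t : ℕ) : Prop :=
  (∀ e ∈ sset f I H φ, c e = 0) ∧ #{e ∈ nset f I H ψ | c e = 0} ≤ t

variable {c c' f g I}

theorem exposed_of_independent {D D' t₃ t₄ : ℕ}
    (hI : ∀ u ∈ I, ∀ v ∈ I, ¬ Bite c c' f g u v)
    (h3 : #{t ∈ packing c | 2 ≤ #(t ∩ I.image f)} ≤ t₃)
    (h4 : #{e ∈ ebad c' f g I D' | c e = 0} ≤ t₄) :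
    Exposed c f I (hi c f I D) (asg c f I (hi c f I D)) (asg c' g I (hi c' g I D'))
      (t₄ + 3 * t₃) := by
  constructor
  · intro e he
    obtain ⟨x, hx, rfl⟩ := mem_image.mp he
    simp only [mem_filter, mem_product] at hx
    obtain ⟨-, -, u, hu, hux, hφ⟩ := hx
    have := (asg_eq_some c f I hφ).2
    rw [nb, mem_filter, base_adj, hux] at this
    exact this.2.2
  · set X := I.image f with hX
    set F := {t ∈ packing c | 2 ≤ #(t ∩ X)} with hF
    have hsub : {e ∈ nset f I (hi c f I D) (asg c' g I (hi c' g I D')) | c e = 0} ⊆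
        {e ∈ ebad c' f g I D' | c e = 0} ∪
          F.biUnion fun t => edgesIn t := by
      intro e he
      obtain ⟨he, hce⟩ := mem_filter.mp he
      obtain ⟨⟨a, a'⟩, hx, rfl⟩ := mem_image.mp he
      simp only [mem_filter, mem_offDiag, mem_sdiff] at hx
      obtain ⟨⟨⟨ha, -⟩, ⟨ha', -⟩, hne⟩, hψ⟩ := hx
      have hadj : (base c).Adj a a' := ⟨hne, hce⟩
      rw [mem_union]
      by_cases hcl : Cl c' g (rep f I a) (rep f I a')
      · left
        exact mem_filter.mpr ⟨mem_image.mpr ⟨(a, a'), mem_filter.mpr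
          ⟨mem_offDiag.mpr ⟨ha, ha', hne⟩, hcl, hψ⟩, rfl⟩, hce⟩
      · right
        have h5 := hI _ (rep_mem ha) _ (rep_mem ha')
        have h6 : ¬ (thin c).Adj a a' := fun h => h5 ⟨by rwa [apply_rep ha, apply_rep ha'], hcl⟩
        rw [thin_adj, not_and, not_not] at h6
        obtain ⟨t, ht, hat, hat'⟩ := h6 hadj
        refine mem_biUnion.mpr ⟨t, mem_filter.mpr ⟨ht, ?_⟩, mem_image.mpr
          ⟨(a, a'), mem_offDiag.mpr ⟨hat, hat', hne⟩, rfl⟩⟩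
        exact one_lt_card.mpr ⟨a, mem_inter.mpr ⟨hat, ha⟩, a', mem_inter.mpr ⟨hat', ha'⟩, hne⟩
    refine (card_le_card hsub).trans ((card_union_le _ _).trans (Nat.add_le_add h4 ?_))
    refine card_biUnion_le.trans ((sum_le_card_nsmul _ _ 3 fun t ht => ?_).trans ?_)
    · have := ((packing_isPacking c).1 t (mem_filter.mp ht).1).card_eq
      refine (Sym2.card_image_offDiag t).le.trans ?_
      rw [this]
      decide
    · rw [smul_eq_mul, mul_comm]
      exact Nat.mul_le_mul_left _ h3

end Exposed

section Events

variable {V : Type*} [Fintype V] {r b : ℕ} [NeZero b]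

theorem pr_not_partsLe_le [NeZero r] {S : ℕ} {m θ : ℝ} (hθ : 0 ≤ θ) (hθ1 : θ ≤ 1)
    (hm : (Fintype.card V : ℝ) / r ≤ m) (hS : (1 + θ) * m ≤ S + 1) :
    pr (fun f : V → Fin r => ¬ PartsLe f S) ≤ r * Real.exp (-(θ ^ 2 * m / 4)) := by
  calc _ ≤ pr (fun f : V → Fin r => ∃ a ∈ (univ : Finset (Fin r)),
          (1 + θ) * m ≤ #{u ∈ (univ : Finset V) | f u = a}) := by
        refine pr_mono fun f hf => ?_
        simp only [PartsLe, not_forall, not_le] at hf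
        obtain ⟨a, ha⟩ := hf
        refine ⟨a, mem_univ _, hS.trans ?_⟩
        exact_mod_cast ha
    _ ≤ ∑ a : Fin r, _ := pr_exists_le _ _
    _ ≤ ∑ _a : Fin r, Real.exp (-(θ ^ 2 * m / 4)) :=
        sum_le_sum fun a _ => pr_count_ge_one_add_mul univ a hθ hθ1 (by rwa [card_univ])
    _ = _ := by rw [sum_const, card_univ, Fintype.card_fin, nsmul_eq_mul]

/-- The degrees of the base graph are at most `d`. -/
def DegLe (c : Sym2 (Fin r) → Fin b) (d : ℕ) : Prop := ∀ i, #{a | (base c).Adj a i} ≤ d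

theorem pr_not_degLe_le {d : ℕ} {m θ : ℝ} (hθ : 0 ≤ θ) (hθ1 : θ ≤ 1)
    (hm : (r : ℝ) / b ≤ m) (hd : (1 + θ) * m ≤ d + 1) :
    pr (fun c : Sym2 (Fin r) → Fin b => ¬ DegLe c d) ≤ r * Real.exp (-(θ ^ 2 * m / 4)) := by
  calc _ ≤ pr (fun c : Sym2 (Fin r) → Fin b => ∃ i ∈ (univ : Finset (Fin r)),
          (1 + θ) * m ≤ #{e ∈ univ.image fun a => s(a, i) | c e = 0}) := by
        refine pr_mono fun c hc => ?_
        simp only [DegLe, not_forall, not_le] at hc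
        obtain ⟨i, hi⟩ := hc
        refine ⟨i, mem_univ _, hd.trans ?_⟩
        refine le_trans (by exact_mod_cast hi) (Nat.cast_le.mpr ?_)
        refine card_le_card_of_injOn (fun a => s(a, i)) (fun a ha => ?_) ?_
        · simp only [coe_filter, mem_univ, true_and, Set.mem_ofPred_eq, base_adj] at ha
          exact mem_coe.mpr (mem_filter.mpr ⟨mem_image_of_mem _ (mem_univ _), ha.2⟩)
        · intro a _ a' _ h
          exact Sym2.congr_left.mp h
    _ ≤ ∑ i : Fin r, _ := pr_exists_le _ _
    _ ≤ ∑ _a : Fin r, Real.exp (-(θ ^ 2 * m / 4)) := by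
        refine sum_le_sum fun a _ => pr_count_ge_one_add_mul _ 0 hθ hθ1 (le_trans ?_ hm)
        gcongr
        exact card_image_le.trans (by rw [card_univ, Fintype.card_fin])
    _ = _ := by rw [sum_const, card_univ, Fintype.card_fin, nsmul_eq_mul]

theorem pr_not_codegLe_le {K : ℕ} :
    pr (fun c : Sym2 (Fin r) → Fin b => ¬ CodegLe c K) ≤
      r ^ 2 * (Real.exp 1 * r / ((K + 1 : ℕ) * b ^ 2)) ^ (K + 1) := by
  have hb : (0 : ℝ) < b := Nat.cast_pos.mpr (NeZero.pos b)
  set cand : Finset ((Fin r × Fin r) × Finset (Fin r)) :=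
    {x ∈ univ ×ˢ univ.powersetCard (K + 1) | x.1.1 ≠ x.1.2 ∧ x.1.1 ∉ x.2 ∧ x.1.2 ∉ x.2} with hcand
  set E : (Fin r × Fin r) × Finset (Fin r) → Finset (Sym2 (Fin r)) := fun x =>
    (x.2 ×ˢ {x.1.1, x.1.2}).image Sym2.mk.uncurry with hE
  have hEcard : ∀ x ∈ cand, #(E x) = 2 * (K + 1) := by
    rintro ⟨⟨i, j⟩, A⟩ hx
    simp only [hcand, mem_filter, mem_product, mem_powersetCard] at hx
    obtain ⟨⟨-, -, hA⟩, hij, hi, hj⟩ := hx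
    rw [hE, card_image_of_injOn, card_product, card_pair hij, hA, mul_comm]
    rintro ⟨x, y⟩ hx ⟨x', y'⟩ hx' h
    simp only [coe_product, Set.mem_prod, mem_coe, mem_insert, mem_singleton] at hx hx'
    simp only [Function.uncurry, Sym2.eq_iff] at h
    rcases h with ⟨rfl, rfl⟩ | ⟨rfl, -⟩
    · rfl
    · rcases hx'.2 with rfl | rfl
      · exact absurd hx.1 hi
      · exact absurd hx.1 hj
  calc _ ≤ pr (fun c : Sym2 (Fin r) → Fin b => ∃ x ∈ cand, ∀ e ∈ E x, c e = 0) := by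
        refine pr_mono fun c hc => ?_
        simp only [CodegLe, not_forall, not_le] at hc
        obtain ⟨i, j, hij, hK⟩ := hc
        obtain ⟨A, hA, hcard⟩ := exists_subset_card_eq (Nat.succ_le_of_lt hK)
        have hA' : ∀ a ∈ A, (base c).Adj a i ∧ (base c).Adj a j := fun a ha =>
          (mem_filter.mp (hA ha)).2
        refine ⟨((i, j), A), mem_filter.mpr ⟨mem_product.mpr ⟨mem_univ _,
          mem_powersetCard.mpr ⟨subset_univ _, hcard⟩⟩, hij, fun h => (hA' i h).1.1 rfl,
          fun h => (hA' j h).2.1 rfl⟩, fun e he => ?_⟩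
        obtain ⟨⟨a, y⟩, hx, rfl⟩ := mem_image.mp he
        simp only [mem_product, mem_insert, mem_singleton] at hx
        rcases hx.2 with rfl | rfl
        · exact (hA' a hx.1).1.2
        · exact (hA' a hx.1).2.2
    _ ≤ ∑ x ∈ cand, _ := pr_exists_le _ _
    _ = ∑ _x ∈ cand, (1 / b : ℝ) ^ (2 * (K + 1)) :=
        sum_congr rfl fun x hx => by rw [pr_all_eq, hEcard x hx]
    _ ≤ r ^ 2 * (r.choose (K + 1)) * (1 / b : ℝ) ^ (2 * (K + 1)) := by
        rw [sum_const, nsmul_eq_mul]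
        refine mul_le_mul_of_nonneg_right ?_ (by positivity)
        have h1 : #cand ≤ r ^ 2 * r.choose (K + 1) := by
          refine (card_le_card (filter_subset _ _)).trans ?_
          rw [card_product, card_powersetCard, card_univ, card_univ, Fintype.card_prod,
            Fintype.card_fin, sq]
        exact_mod_cast h1
    _ ≤ r ^ 2 * (Real.exp 1 * r / (K + 1 : ℕ)) ^ (K + 1) * (1 / b : ℝ) ^ (2 * (K + 1)) := by
        gcongr
        exact choose_le_exp_mul_div_pow _ _
    _ = _ := by
        rw [mul_assoc, pow_mul, ← mul_pow]
        congr 2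
        field_simp

theorem card_edgesIn_le (X : Finset (Fin r)) : #(edgesIn X) ≤ #X ^ 2 := by
  refine card_image_le.trans ?_
  rw [offDiag_card, sq]
  exact Nat.sub_le _ _

theorem pr_edgesIn_le (X : Finset (Fin r)) {k t : ℕ} (hX : #X ≤ k) :
    pr (fun c : Sym2 (Fin r) → Fin b => t ≤ #{e ∈ edgesIn X | c e = 0}) ≤
      (Real.exp 1 * k ^ 2 / (b * t)) ^ t := by
  refine pr_count_ge' _ _ _ _ ?_
  exact_mod_cast (card_edgesIn_le X).trans (Nat.pow_le_pow_left hX 2)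

theorem pr_packing_le (X : Finset (Fin r)) {k t : ℕ} (hX : #X ≤ k) :
    pr (fun c : Sym2 (Fin r) → Fin b => t ≤ #{s ∈ packing c | 2 ≤ #(s ∩ X)}) ≤
      (Real.exp 1 * (k ^ 2 * r) / (b ^ 3 * t)) ^ t := by
  have hb : (0 : ℝ) < b := Nat.cast_pos.mpr (NeZero.pos b)
  set cand : Finset (Finset (Fin r)) := {s ∈ univ.powersetCard 3 | 2 ≤ #(s ∩ X)} with hcand
  have hcard : #cand ≤ k ^ 2 * r := by
    calc #cand ≤ #(((X ×ˢ X) ×ˢ univ).image fun x => ({x.1.1, x.1.2, x.2} : Finset (Fin r))) := by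
          refine card_le_card fun s hs => ?_
          simp only [hcand, mem_filter, mem_powersetCard] at hs
          obtain ⟨⟨-, h3⟩, h2⟩ := hs
          obtain ⟨x, hx, y, hy, hxy⟩ := one_lt_card.mp h2
          rw [mem_inter] at hx hy
          have hsub : {x, y} ⊆ s := by
            intro z hz
            rw [mem_insert, mem_singleton] at hz
            rcases hz with rfl | rfl
            · exact hx.1
            · exact hy.1
          have h4 : #(s \ {x, y}) = 1 := by
            rw [card_sdiff_of_subset hsub, h3, card_pair hxy]
          obtain ⟨z, hz⟩ := card_eq_one.mp h4
          refine mem_image.mpr ⟨((x, y), z), mem_product.mpr ⟨mem_product.mpr ⟨hx.2, hy.2⟩,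
            mem_univ _⟩, ?_⟩
          rw [← sdiff_union_of_subset hsub, hz]
          ext w
          simp only [mem_insert, mem_singleton, mem_union]
          tauto
      _ ≤ #X * #X * r := by
          refine card_image_le.trans ?_
          rw [card_product, card_product, card_univ, Fintype.card_fin]
      _ ≤ k ^ 2 * r := by
          rw [sq]
          gcongr
  set fam : Finset (Finset (Finset (Fin r))) :=
    {T ∈ cand.powersetCard t | ∀ s ∈ T, ∀ s' ∈ T, s ≠ s' → #(s ∩ s') ≤ 1} with hfam
  have hEcard : ∀ T ∈ fam, #(T.biUnion edgesIn) = 3 * t := by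
    intro T hT
    rw [hfam, mem_filter, mem_powersetCard] at hT
    obtain ⟨⟨hT, hTt⟩, hdis⟩ := hT
    rw [card_biUnion]
    · rw [← hTt, mul_comm, ← smul_eq_mul, ← sum_const]
      refine sum_congr rfl fun s hs => ?_
      have := hT hs
      rw [hcand, mem_filter, mem_powersetCard] at this
      refine (Sym2.card_image_offDiag s).trans ?_
      rw [this.1.2]
      decide
    · intro s hs s' hs' hne
      rw [Function.onFun, disjoint_left]
      intro e he he'
      obtain ⟨⟨x, y⟩, hx, rfl⟩ := mem_image.mp he
      obtain ⟨⟨x', y'⟩, hx', h⟩ := mem_image.mp he'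
      simp only [mem_offDiag] at hx hx'
      simp only [Function.uncurry, Sym2.eq_iff] at h
      have h1 := hdis s hs s' hs' hne
      refine absurd (one_lt_card.mpr ⟨x, mem_inter.mpr ⟨hx.1, ?_⟩, y,
        mem_inter.mpr ⟨hx.2.1, ?_⟩, hx.2.2⟩) (not_lt.mpr h1)
      · rcases h with ⟨rfl, rfl⟩ | ⟨rfl, rfl⟩
        · exact hx'.1
        · exact hx'.2.1
      · rcases h with ⟨rfl, rfl⟩ | ⟨rfl, rfl⟩
        · exact hx'.2.1
        · exact hx'.1
  calc _ ≤ pr (fun c : Sym2 (Fin r) → Fin b => ∃ T ∈ fam, ∀ e ∈ T.biUnion edgesIn, c e = 0) := by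
        refine pr_mono fun c hc => ?_
        obtain ⟨T, hT, hcT⟩ := exists_subset_card_eq hc
        have hp := packing_isPacking c
        have hT' : ∀ s ∈ T, (base c).IsNClique 3 s ∧ 2 ≤ #(s ∩ X) := fun s hs =>
          ⟨hp.1 s (mem_filter.mp (hT hs)).1, (mem_filter.mp (hT hs)).2⟩
        refine ⟨T, mem_filter.mpr ⟨mem_powersetCard.mpr ⟨fun s hs => mem_filter.mpr
          ⟨mem_powersetCard.mpr ⟨subset_univ _, (hT' s hs).1.card_eq⟩, (hT' s hs).2⟩, hcT⟩,
          fun s hs s' hs' => hp.2 s (mem_filter.mp (hT hs)).1 s' (mem_filter.mp (hT hs')).1⟩, ?_⟩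
        intro e he
        obtain ⟨s, hs, he⟩ := mem_biUnion.mp he
        obtain ⟨⟨x, y⟩, hx, rfl⟩ := mem_image.mp he
        rw [mem_offDiag] at hx
        exact ((hT' s hs).1.isClique hx.1 hx.2.1 hx.2.2).2
    _ ≤ ∑ T ∈ fam, _ := pr_exists_le _ _
    _ = ∑ _T ∈ fam, (1 / b : ℝ) ^ (3 * t) :=
        sum_congr rfl fun T hT => by rw [pr_all_eq, hEcard T hT]
    _ ≤ ((k ^ 2 * r).choose t : ℕ) * (1 / b : ℝ) ^ (3 * t) := by
        rw [sum_const, nsmul_eq_mul]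
        refine mul_le_mul_of_nonneg_right ?_ (by positivity)
        rw [Nat.cast_le]
        refine (card_le_card (filter_subset _ _)).trans ?_
        rw [card_powersetCard]
        exact Nat.choose_le_choose _ hcard
    _ ≤ (Real.exp 1 * (k ^ 2 * r : ℕ) / t) ^ t * (1 / b : ℝ) ^ (3 * t) := by
        gcongr
        exact choose_le_exp_mul_div_pow _ _
    _ = _ := by
        rw [pow_mul, ← mul_pow]
        push_cast
        congr 1
        rcases Nat.eq_zero_or_pos t with rfl | ht
        · simp
        · field_simp

theorem sum_load_eq (f : V → Fin r) (I : Finset V) : ∑ a ∈ I.image f, load f I a = #I := by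
  simp only [load]
  rw [← Nat.cast_sum, ← card_eq_sum_card_image]

theorem pr_outsideSum_le {f : V → Fin r} {I : Finset V} {S D : ℕ} (hS : PartsLe f S) {l T : ℝ}
    (hl : 0 ≤ l) (hlD : l * D * S ≤ 1) :
    pr (fun c : Sym2 (Fin r) → Fin b => T ≤ outsideSum c f I D) ≤
      Real.exp (r * (9 * l * #I ^ 2 * (1 / b) ^ 2 * Real.exp (2 * (1 / b) * (l * D) * #I))
        - l * T) := by
  refine pr_outside_cherries (I.image f) (w := load f I) (fun a => Nat.cast_nonneg _) hl
    (Nat.cast_nonneg D) (fun a => le_trans ?_ hlD) (sum_load_eq f I).le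
  refine mul_le_mul_of_nonneg_left (Nat.cast_le.mpr ?_) (by positivity)
  exact (card_le_card (filter_subset_filter _ (subset_univ I))).trans (hS a)

theorem pr_ebad_le [Nonempty V] (c' : Sym2 (Fin r) → Fin b) (f g : V → Fin r) (I : Finset V)
    (D : ℕ) {t : ℕ} {m : ℝ} (hm : 0 ≤ m) :
    pr (fun c : Sym2 (Fin r) → Fin b =>
      (#(ebad c' f g I D) : ℝ) ≤ m ∧ t ≤ #{e ∈ ebad c' f g I D | c e = 0}) ≤
      (Real.exp 1 * m / (b * t)) ^ t := by
  by_cases h : (#(ebad c' f g I D) : ℝ) ≤ m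
  · exact (pr_mono fun c hc => hc.2).trans (pr_count_ge' _ _ _ _ h)
  · rw [pr_false_of_le_zero _ fun c hc => h hc.1]
    positivity

end Events

section Gap

variable {ι : Type*}

theorem sum_two_mul_sub_sq_ge (H : Finset ι) {a α : ι → ℝ} {u κ : ℝ} (ha : ∀ i ∈ H, 0 ≤ a i)
    (haα : ∀ i ∈ H, a i ≤ α i) (hα : ∀ i ∈ H, α i ≤ κ) (hκ : κ ≤ 1 / 2) (hκ0 : 0 ≤ κ)
    (hu : ∑ i ∈ H, (α i - a i) ≤ u) :
    ∑ i ∈ H, a i + max 0 (u ^ 2 - κ * u) ≤ u ^ 2 + 2 * ∑ i ∈ H, a i - ∑ i ∈ H, α i ^ 2 := by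
  have hd : ∀ i ∈ H, 0 ≤ α i - a i := fun i hi => sub_nonneg.mpr (haα i hi)
  have hs0 : 0 ≤ ∑ i ∈ H, (α i - a i) := sum_nonneg hd
  have h1 : ∑ i ∈ H, α i ^ 2 ≤ ∑ i ∈ H, (α i - a i) ^ 2 + ∑ i ∈ H, a i := by
    rw [← sum_add_distrib]
    refine sum_le_sum fun i hi => ?_
    have := ha i hi
    have := haα i hi
    have := hα i hi
    nlinarith
  have h2 : ∑ i ∈ H, (α i - a i) ^ 2 ≤ κ * u := by
    calc _ ≤ ∑ i ∈ H, κ * (α i - a i) := by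
          refine sum_le_sum fun i hi => ?_
          have := ha i hi
          have := hd i hi
          have := hα i hi
          nlinarith
      _ ≤ κ * u := by
          rw [← mul_sum]
          exact mul_le_mul_of_nonneg_left hu hκ0
  have h3 : ∑ i ∈ H, (α i - a i) ^ 2 ≤ u ^ 2 := by
    calc _ ≤ (∑ i ∈ H, (α i - a i)) ^ 2 := sum_sq_le_sq_sum_of_nonneg hd
      _ ≤ u ^ 2 := pow_le_pow_left₀ hs0 hu 2
  rcases max_cases 0 (u ^ 2 - κ * u) with h | h <;> rw [h.1] <;> linarith

theorem exponent_gap {ι' : Type*} (H : Finset ι) (H' : Finset ι') {a α : ι → ℝ} {a' α' : ι' → ℝ}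
    {u v c e : ℝ} (hc : 0 < c) (hc1 : c ≤ 1) (he : 0 ≤ e) (he1 : e ≤ 1 / 8)
    (ha : ∀ i ∈ H, 0 ≤ a i) (haα : ∀ i ∈ H, a i ≤ α i) (hα : ∀ i ∈ H, α i ≤ (1 - c) / 2)
    (hu : ∑ i ∈ H, (α i - a i) ≤ u)
    (ha' : ∀ i ∈ H', 0 ≤ a' i) (haα' : ∀ i ∈ H', a' i ≤ α' i) (hα' : ∀ i ∈ H', α' i ≤ (1 - c) / 2)
    (hv : ∑ i ∈ H', (α' i - a' i) ≤ v) :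
    (1 - u - v) + e * c / 2 ≤ ∑ i ∈ H, a i + ∑ i ∈ H', a' i + (1 + e) / 2 *
      ((1 - u) ^ 2 + (1 - v) ^ 2 - ∑ i ∈ H, α i ^ 2 - ∑ i ∈ H', α' i ^ 2) := by
  have h1 := sum_two_mul_sub_sq_ge H ha haα hα (by linarith) (by linarith) hu
  have h2 := sum_two_mul_sub_sq_ge H' ha' haα' hα' (by linarith) (by linarith) hv
  have hu0 : 0 ≤ u := (sum_nonneg fun i hi => sub_nonneg.mpr (haα i hi)).trans hu
  have hv0 : 0 ≤ v := (sum_nonneg fun i hi => sub_nonneg.mpr (haα' i hi)).trans hv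
  have hA : 0 ≤ ∑ i ∈ H, a i := sum_nonneg ha
  have hA' : 0 ≤ ∑ i ∈ H', a' i := sum_nonneg ha'
  set A := ∑ i ∈ H, a i
  set A' := ∑ i ∈ H', a' i
  set Q := ∑ i ∈ H, α i ^ 2
  set Q' := ∑ i ∈ H', α' i ^ 2
  set m := max 0 (u ^ 2 - (1 - c) / 2 * u)
  set m' := max 0 (v ^ 2 - (1 - c) / 2 * v)
  have hm0 : 0 ≤ m := le_max_left _ _
  have hm : u ^ 2 - (1 - c) / 2 * u ≤ m := le_max_right _ _
  have hm0' : 0 ≤ m' := le_max_left _ _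
  have hm' : v ^ 2 - (1 - c) / 2 * v ≤ m' := le_max_right _ _
  have key : e * c / 2 ≤ (m + m') / 2 + e * (1 - (u + v)) := by
    rcases le_or_gt (u + v) (1 - c / 2) with h | h
    · nlinarith
    · have h3 : (u + v) * (u + v - 1 + c) / 2 ≤ m + m' := by nlinarith [sq_nonneg (u - v)]
      rcases le_or_gt (u + v) 1 with h4 | h4
      · have h5 : c / 8 ≤ (m + m') / 2 * 2 := by nlinarith
        nlinarith
      · nlinarith
  have h5 : (1 - u) ^ 2 + (1 - v) ^ 2 - Q - Q' ≥
      2 * (1 - u - v) + (A + m) + (A' + m') - 2 * A - 2 * A' := by nlinarith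
  have h6 : (1 + e) / 2 * ((1 - u) ^ 2 + (1 - v) ^ 2 - Q - Q') ≥
      (1 + e) / 2 * (2 * (1 - u - v) + (A + m) + (A' + m') - 2 * A - 2 * A') :=
    mul_le_mul_of_nonneg_left h5 (by linarith)
  nlinarith [mul_nonneg he hm0, mul_nonneg he hm0']

end Gap

section Main

variable {V : Type*} [Fintype V] [Nonempty V] {r b : ℕ} [NeZero b]

/-- The candidates for the assignment of vertices to centres. -/
noncomputable def assignments (I : Finset V) (H : Finset (Fin r)) : Finset (V → Option (Fin r)) :=
  Fintype.piFinset fun u => if u ∈ I then insertNone H else {none}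

theorem card_assignments (I : Finset V) (H : Finset (Fin r)) :
    #(assignments I H) = (#H + 1) ^ #I := by
  rw [assignments, Fintype.card_piFinset]
  have : ∀ u : V, #(if u ∈ I then insertNone H else ({none} : Finset (Option (Fin r)))) =
      if u ∈ I then #H + 1 else 1 := fun u => by
    split_ifs
    · exact card_insertNone H
    · rfl
  simp only [this, prod_ite, prod_const_one, mul_one, prod_const]
  congr 2
  ext u
  simp

theorem mem_of_assignments {I : Finset V} {H : Finset (Fin r)} {φ : V → Option (Fin r)}
    (h : φ ∈ assignments I H) {u : V} {i : Fin r} (hu : φ u = some i) : i ∈ H := by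
  have := Fintype.mem_piFinset.mp h u
  split_ifs at this
  · exact some_mem_insertNone.mp (hu ▸ this)
  · rw [hu] at this
    simp at this

theorem asg_mem_assignments (c : Sym2 (Fin r) → Fin b) (f : V → Fin r) (I : Finset V)
    (H : Finset (Fin r)) : asg c f I H ∈ assignments I H := by
  refine Fintype.mem_piFinset.mpr fun u => ?_
  split_ifs with hu
  · rcases h : asg c f I H u with _ | i
    · exact none_mem_insertNone
    · exact some_mem_insertNone.mpr (asg_eq_some c f I h).1
  · rw [asg_eq_none c f I H hu]
    exact mem_singleton_self _

/-- The choices of few centres, together with an assignment of vertices to them. -/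
noncomputable def choices (I : Finset V) (r h M : ℕ) :
    Finset ((_ : Finset (Fin r)) × (V → Option (Fin r))) :=
  {x ∈ ({H | #H ≤ h} : Finset (Finset (Fin r))).sigma fun H => assignments I H |
    ∀ i ∈ x.1, #{u ∈ I | x.2 u = some i} ≤ M}

theorem card_choices_le (I : Finset V) (h M : ℕ) :
    #(choices I r h M) ≤ (h + 1) * (r + 1) ^ h * (h + 1) ^ #I := by
  refine (card_le_card (filter_subset _ _)).trans ?_
  rw [card_sigma]
  have h1 : #({H | #H ≤ h} : Finset (Finset (Fin r))) ≤ (h + 1) * (r + 1) ^ h := by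
    calc _ ≤ #((range (h + 1)).biUnion fun j => (univ : Finset (Fin r)).powersetCard j) := by
          refine card_le_card fun H hH => ?_
          exact mem_biUnion.mpr ⟨#H, mem_range.mpr (Nat.lt_succ_of_le (mem_filter.mp hH).2),
            mem_powersetCard.mpr ⟨subset_univ _, rfl⟩⟩
      _ ≤ ∑ j ∈ range (h + 1), #((univ : Finset (Fin r)).powersetCard j) := card_biUnion_le
      _ ≤ ∑ _j ∈ range (h + 1), (r + 1) ^ h := by
          refine sum_le_sum fun j hj => ?_
          rw [card_powersetCard, card_univ, Fintype.card_fin]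
          calc r.choose j ≤ r ^ j := Nat.choose_le_pow r j
            _ ≤ (r + 1) ^ j := Nat.pow_le_pow_left (Nat.le_succ r) j
            _ ≤ (r + 1) ^ h :=
                Nat.pow_le_pow_right (Nat.succ_pos r) (Nat.le_of_lt_succ (mem_range.mp hj))
      _ = _ := by rw [sum_const, card_range, smul_eq_mul]
  calc _ ≤ ∑ _H ∈ ({H | #H ≤ h} : Finset (Finset (Fin r))), (h + 1) ^ #I := by
        refine sum_le_sum fun H hH => ?_
        rw [card_assignments]
        exact Nat.pow_le_pow_left (Nat.succ_le_succ (mem_filter.mp hH).2) _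
    _ ≤ _ := by
        rw [sum_const, smul_eq_mul]
        exact Nat.mul_le_mul_right _ h1

theorem pr_exposed_le (f : V → Fin r) (I : Finset V) (H : Finset (Fin r))
    (φ ψ : V → Option (Fin r)) (t : ℕ) {z q : ℝ} (hz : 0 < z) (hz1 : z ≤ 1)
    (hq : q ≤ (1 / b) * (1 - z)) :
    pr (fun c : Sym2 (Fin r) → Fin b => Exposed c f I H φ ψ t) ≤
      Real.exp (-(Real.log b * #(sset f I H φ) + q * #(nset f I H ψ))) * (z⁻¹) ^ t := by
  have hb : (0 : ℝ) < b := Nat.cast_pos.mpr (NeZero.pos b)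
  refine (pr_all_and_count_le (disjoint_sset_nset f I H φ ψ) 0 t hz hz1).trans ?_
  have h1 : (1 / b : ℝ) = Real.exp (-Real.log b) := by
    rw [Real.exp_neg, Real.exp_log hb, one_div]
  refine mul_le_mul_of_nonneg_right ?_ (by positivity)
  calc (1 / b : ℝ) ^ #(sset f I H φ) * Real.exp (-((1 / b) * (1 - z) * #(nset f I H ψ)))
      = Real.exp (-(Real.log b * #(sset f I H φ) + (1 / b) * (1 - z) * #(nset f I H ψ))) := by
        rw [neg_add, Real.exp_add, h1, ← Real.exp_nat_mul]
        congr 2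
        ring
    _ ≤ _ := by gcongr

theorem exponent_le {f g : V → Fin r} {I : Finset V} {k h M : ℕ} (hI : #I = k) (hk : 0 < k)
    {c e L : ℝ} (hc : 0 < c) (hc1 : c ≤ 1) (he : 0 ≤ e) (he1 : e ≤ 1 / 8) (hL : 0 ≤ L)
    (hM : (M : ℝ) ≤ (1 - c) / 2 * k)
    {x y : (_ : Finset (Fin r)) × (V → Option (Fin r))}
    (hx : x ∈ choices I r h M) (hy : y ∈ choices I r h M) :
    L * (#(I.image f) + #(I.image g) - k + e * c / 2 * k - 2 * h ^ 2 - 2 * (2 * h + 1)) ≤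
    L * #(sset f I x.1 x.2) + (1 + e) * L / k * #(nset f I x.1 y.2) +
      (L * #(sset g I y.1 y.2) + (1 + e) * L / k * #(nset g I y.1 x.2)) := by
  have hk' : (0 : ℝ) < k := Nat.cast_pos.mpr hk
  obtain ⟨H, φ⟩ := x
  obtain ⟨H', ψ⟩ := y
  simp only [choices, mem_filter, mem_sigma, mem_univ, true_and] at hx hy
  obtain ⟨⟨hH, hφ⟩, hMx⟩ := hx
  obtain ⟨⟨hH', hψ⟩, hMy⟩ := hy
  have n1 := card_nset_ge f I H H' (ψ := ψ) (fun u i h => mem_of_assignments hψ h) hH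
  have n2 := card_nset_ge g I H' H (ψ := φ) (fun u i h => mem_of_assignments hφ h) hH'
  have s1 : (∑ i ∈ H, (#({u ∈ I | φ u = some i}.image f) : ℝ)) ≤ #(sset f I H φ) + h ^ 2 := by
    have := sum_card_image_le_card_sset f I H φ
    have h2 : #H * #H ≤ h ^ 2 := by rw [sq]; exact Nat.mul_le_mul hH hH
    exact_mod_cast this.trans (Nat.add_le_add_left h2 _)
  have s2 : (∑ i ∈ H', (#({u ∈ I | ψ u = some i}.image g) : ℝ)) ≤ #(sset g I H' ψ) + h ^ 2 := by
    have := sum_card_image_le_card_sset g I H' ψ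
    have h2 : #H' * #H' ≤ h ^ 2 := by rw [sq]; exact Nat.mul_le_mul hH' hH'
    exact_mod_cast this.trans (Nat.add_le_add_left h2 _)
  have t1 : (#(I.image f) : ℝ) + ∑ i ∈ H, (#{u ∈ I | φ u = some i} : ℝ) ≤
      ∑ i ∈ H, (#({u ∈ I | φ u = some i}.image f) : ℝ) + k := by
    rw [← hI]; exact_mod_cast card_image_le_structural f I H φ
  have t2 : (#(I.image g) : ℝ) + ∑ i ∈ H', (#{u ∈ I | ψ u = some i} : ℝ) ≤
      ∑ i ∈ H', (#({u ∈ I | ψ u = some i}.image g) : ℝ) + k := by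
    rw [← hI]; exact_mod_cast card_image_le_structural g I H' ψ
  have x1 : (#(I.image f) : ℝ) ≤ k := by rw [← hI]; exact_mod_cast card_image_le
  have y1 : (#(I.image g) : ℝ) ≤ k := by rw [← hI]; exact_mod_cast card_image_le
  have hh0 : (0 : ℝ) ≤ h := Nat.cast_nonneg h
  have X0 : (0 : ℝ) ≤ #(I.image f) := Nat.cast_nonneg _
  have Y0 : (0 : ℝ) ≤ #(I.image g) := Nat.cast_nonneg _
  have gap := exponent_gap H H' (c := c) (e := e) (u := 1 - #(I.image f) / k)
    (v := 1 - #(I.image g) / k)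
    (a := fun i => #({u ∈ I | φ u = some i}.image f) / k)
    (α := fun i => #{u ∈ I | φ u = some i} / k)
    (a' := fun i => #({u ∈ I | ψ u = some i}.image g) / k)
    (α' := fun i => #{u ∈ I | ψ u = some i} / k) hc hc1 he he1
    (fun i _ => by positivity)
    (fun i _ => by gcongr; exact card_image_le)
    (fun i hi => by
      rw [div_le_iff₀ hk']
      exact le_trans (Nat.cast_le.mpr (hMx i hi)) hM)
    (by
      rw [sum_sub_distrib, ← sum_div, ← sum_div, ← sub_div, le_sub_iff_add_le, ← add_div,
        div_le_one hk']
      linarith)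
    (fun i _ => by positivity)
    (fun i _ => by gcongr; exact card_image_le)
    (fun i hi => by
      rw [div_le_iff₀ hk']
      exact le_trans (Nat.cast_le.mpr (hMy i hi)) hM)
    (by
      rw [sum_sub_distrib, ← sum_div, ← sum_div, ← sub_div, le_sub_iff_add_le, ← add_div,
        div_le_one hk']
      linarith)
  simp only [div_pow, ← sum_div] at gap
  set X : ℝ := (#(I.image f) : ℝ)
  set Y : ℝ := (#(I.image g) : ℝ)
  set A : ℝ := ∑ i ∈ H, (#({u ∈ I | φ u = some i}.image f) : ℝ)
  set A' : ℝ := ∑ i ∈ H', (#({u ∈ I | ψ u = some i}.image g) : ℝ)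
  set Q : ℝ := ∑ i ∈ H, (#{u ∈ I | φ u = some i} : ℝ) ^ 2
  set Q' : ℝ := ∑ i ∈ H', (#{u ∈ I | ψ u = some i} : ℝ) ^ 2
  set N : ℝ := (#(nset f I H ψ) : ℝ)
  set N' : ℝ := (#(nset g I H' φ) : ℝ)
  set S : ℝ := (#(sset f I H φ) : ℝ)
  set S' : ℝ := (#(sset g I H' ψ) : ℝ)
  have gap' : X + Y - k + e * c / 2 * k
      ≤ A + A' + (1 + e) / k * ((X ^ 2 + Y ^ 2 - Q - Q') / 2) := by
    have := mul_le_mul_of_nonneg_left gap hk'.le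
    have e1 : (k : ℝ) * (1 - (1 - X / k) - (1 - Y / k) + e * c / 2) =
        X + Y - k + e * c / 2 * k := by field_simp; ring
    have e2 : (k : ℝ) * (A / k + A' / k + (1 + e) / 2 * ((1 - (1 - X / k)) ^ 2 +
        (1 - (1 - Y / k)) ^ 2 - Q / k ^ 2 - Q' / k ^ 2)) =
        A + A' + (1 + e) / k * ((X ^ 2 + Y ^ 2 - Q - Q') / 2) := by field_simp; ring
    rwa [e1, e2] at this
  have hN : (X ^ 2 + Y ^ 2 - Q - Q') / 2 ≤ N + N' + (2 * h + 1) * k := by nlinarith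
  have hN' := mul_le_mul_of_nonneg_left hN (by positivity : 0 ≤ (1 + e) / k)
  have e3 : (1 + e) / k * (N + N' + (2 * h + 1) * k) =
      (1 + e) / k * N + (1 + e) / k * N' + (1 + e) * (2 * h + 1) := by field_simp
  have e4 : (1 + e) * (2 * h + 1) ≤ 2 * (2 * (h : ℝ) + 1) := by nlinarith
  have fin : X + Y - k + e * c / 2 * k - 2 * h ^ 2 - 2 * (2 * h + 1) ≤
      S + (1 + e) / k * N + (S' + (1 + e) / k * N') := by linarith
  have := mul_le_mul_of_nonneg_left fin hL
  calc _ ≤ _ := this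
    _ = _ := by ring

/-- The event that some choice of centres is exposed in both colours. -/
def AllExposed (f g : V → Fin r) (I : Finset V) (h M t : ℕ)
    (ω : (Sym2 (Fin r) → Fin b) × (Sym2 (Fin r) → Fin b)) : Prop :=
  ∃ x ∈ choices I r h M ×ˢ choices I r h M,
    Exposed ω.1 f I x.1.1 x.1.2 x.2.2 t ∧ Exposed ω.2 g I x.2.1 x.2.2 x.1.2 t

theorem pr_allExposed_le (f g : V → Fin r) {I : Finset V} {k h M : ℕ} (hI : #I = k) (hk : 0 < k)
    {c e z : ℝ} (hc : 0 < c) (hc1 : c ≤ 1) (he : 0 ≤ e) (he1 : e ≤ 1 / 8)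
    (hM : (M : ℝ) ≤ (1 - c) / 2 * k) (t : ℕ) (hz : 0 < z) (hz1 : z ≤ 1)
    (hq : (1 + e) * Real.log b / k ≤ (1 / b) * (1 - z)) :
    pr (AllExposed (b := b) f g I h M t) ≤
      (((h : ℝ) + 1) * (r + 1) ^ h * (h + 1) ^ k) ^ 2 * ((z⁻¹) ^ t) ^ 2 *
        Real.exp (-(Real.log b * (#(I.image f) + #(I.image g) - k + e * c / 2 * k
          - 2 * h ^ 2 - 2 * (2 * h + 1)))) := by
  have hb1 : (1 : ℝ) ≤ b := by exact_mod_cast NeZero.pos b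
  have hL : 0 ≤ Real.log b := Real.log_nonneg hb1
  set W := Real.exp (-(Real.log b * (#(I.image f) + #(I.image g) - k + e * c / 2 * k
          - 2 * h ^ 2 - 2 * (2 * h + 1)))) with hW
  have h1 : ∀ x ∈ choices I r h M ×ˢ choices I r h M,
      pr (fun ω : (Sym2 (Fin r) → Fin b) × (Sym2 (Fin r) → Fin b) =>
        Exposed ω.1 f I x.1.1 x.1.2 x.2.2 t ∧ Exposed ω.2 g I x.2.1 x.2.2 x.1.2 t) ≤
      ((z⁻¹) ^ t) ^ 2 * W := by
    intro x hx
    rw [mem_product] at hx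
    rw [pr_prod_and (fun c => Exposed c f I x.1.1 x.1.2 x.2.2 t)
      (fun c => Exposed c g I x.2.1 x.2.2 x.1.2 t)]
    calc _ ≤ _ := mul_le_mul (pr_exposed_le f I _ _ _ t hz hz1 hq)
            (pr_exposed_le g I _ _ _ t hz hz1 hq) (pr_nonneg _) (by positivity)
      _ = ((z⁻¹) ^ t) ^ 2 * Real.exp (-(Real.log b * #(sset f I x.1.1 x.1.2) +
            (1 + e) * Real.log b / k * #(nset f I x.1.1 x.2.2) +
          (Real.log b * #(sset g I x.2.1 x.2.2) +
            (1 + e) * Real.log b / k * #(nset g I x.2.1 x.1.2)))) := by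
          rw [neg_add (_ + _) (_ + _), Real.exp_add]
          ring
      _ ≤ _ := by
          rw [hW]
          gcongr ?_ * Real.exp (-?_)
          exact exponent_le hI hk hc hc1 he he1 hL hM hx.1 hx.2
  calc _ ≤ ∑ x ∈ choices I r h M ×ˢ choices I r h M, _ := pr_exists_le _ _
    _ ≤ ∑ _x ∈ choices I r h M ×ˢ choices I r h M, ((z⁻¹) ^ t) ^ 2 * W := sum_le_sum h1
    _ ≤ _ := by
        rw [sum_const, nsmul_eq_mul, ← mul_assoc]
        refine mul_le_mul_of_nonneg_right (mul_le_mul_of_nonneg_right ?_ (by positivity))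
          (Real.exp_nonneg _)
        have h2 := card_choices_le (r := r) I h M
        rw [hI] at h2
        rw [card_product, sq]
        exact_mod_cast Nat.mul_le_mul h2 h2

theorem expect_exp_card_image_le [NeZero r] {I : Finset V} {k : ℕ} (hI : #I = k) (hk : 0 < k)
    {Δ : ℝ} (hΔ : 0 ≤ Δ) (hr : (k : ℝ) * b ≤ Real.exp Δ * r) :
    𝔼 f : V → Fin r, Real.exp (-(Real.log b * #(I.image f))) ≤
      (k + 1) * Real.exp (k + Δ * k - Real.log b * k) := by
  have hb : (0 : ℝ) < b := Nat.cast_pos.mpr (NeZero.pos b)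
  have hr0 : (0 : ℝ) < r := Nat.cast_pos.mpr (NeZero.pos r)
  set L := Real.log b
  have hbL : (b : ℝ) = Real.exp L := (Real.exp_log hb).symm
  have h1 : ∀ f : V → Fin r, Real.exp (-(L * #(I.image f))) =
      ∑ x ∈ range (k + 1), (if #(I.image f) = x then (1 : ℝ) else 0) * Real.exp (-(L * x)) := by
    intro f
    rw [sum_eq_single #(I.image f)]
    · simp
    · intro x _ hx
      rw [if_neg hx.symm, zero_mul]
    · intro hx
      exact absurd (mem_range.mpr (Nat.lt_succ_of_le (hI ▸ card_image_le))) hx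
  simp only [h1]
  rw [expect_sum_comm]
  calc _ ≤ ∑ _x ∈ range (k + 1), Real.exp (k + Δ * k - L * k) := by
        refine sum_le_sum fun x hx => ?_
        have hxk : x ≤ k := Nat.le_of_lt_succ (mem_range.mp hx)
        have hxk' : (x : ℝ) ≤ k := by exact_mod_cast hxk
        rw [← expect_mul]
        have h2 := pr_card_image_eq (r := r) I x
        rw [hI] at h2
        have h3 : (r.choose x : ℝ) * ((x : ℝ) / r) ^ k ≤
            Real.exp k * Real.exp ((Δ - L) * (k - x)) := by
          calc (r.choose x : ℝ) * ((x : ℝ) / r) ^ k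
              ≤ (Real.exp 1 * r / x) ^ x * ((x : ℝ) / r) ^ k := by
                gcongr
                exact choose_le_exp_mul_div_pow _ _
            _ ≤ Real.exp x * ((x : ℝ) / r) ^ (k - x) := by
                rcases Nat.eq_zero_or_pos x with rfl | hx0
                · simp
                · have hx0' : (0 : ℝ) < x := Nat.cast_pos.mpr hx0
                  obtain ⟨m, rfl⟩ := Nat.exists_eq_add_of_le hxk
                  rw [pow_add, Nat.add_sub_cancel_left, ← mul_assoc, ← mul_pow]
                  have : Real.exp 1 * r / x * (x / r) = Real.exp 1 := by field_simp
                  rw [this, ← Real.exp_nat_mul, mul_one]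
            _ ≤ Real.exp k * Real.exp (Δ - L) ^ (k - x) := by
                gcongr
                rw [div_le_iff₀ hr0, Real.exp_sub, ← hbL, div_mul_eq_mul_div, le_div_iff₀ hb]
                exact (mul_le_mul_of_nonneg_right hxk' hb.le).trans hr
            _ = _ := by
                rw [← Real.exp_nat_mul, Nat.cast_sub hxk, mul_comm ((k : ℝ) - x)]
        calc _ ≤ Real.exp k * Real.exp ((Δ - L) * (k - x)) * Real.exp (-(L * x)) := by
              refine mul_le_mul_of_nonneg_right ?_ (Real.exp_nonneg _)
              refine le_trans (le_of_eq ?_) (h2.trans h3)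
              rw [pr]
              exact expect_congr rfl fun f _ => by congr
          _ = Real.exp (k + Δ * (k - x) - L * k) := by
              rw [← Real.exp_add, ← Real.exp_add]
              congr 1
              ring
          _ ≤ _ := by
              gcongr
              have : (0 : ℝ) ≤ x := Nat.cast_nonneg x
              linarith
    _ = _ := by
        rw [sum_const, card_range, nsmul_eq_mul]
        push_cast
        rfl

end Main

section Product

variable {Ω Ω' : Type*} [Fintype Ω] [Fintype Ω'] [Nonempty Ω] [Nonempty Ω']

theorem pr_le_of_forall_fst {P : Ω × Ω' → Prop} {x : ℝ} (h : ∀ a, pr (fun b => P (a, b)) ≤ x) :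
    pr P ≤ x := by
  rw [pr_prod]
  exact expect_le_of_le h

theorem pr_le_of_forall_snd {P : Ω × Ω' → Prop} {x : ℝ} (h : ∀ b, pr (fun a => P (a, b)) ≤ x) :
    pr P ≤ x := by
  rw [pr_prod']
  exact expect_le_of_le h

end Product

section Assembly

variable {V : Type*} [Fintype V] [Nonempty V] {r b : ℕ} [NeZero b]

/-- The exceptional events, for a given set `I`, which have tiny probability. -/
def Rare (f g : V → Fin r) (I : Finset V) (D e₁ t₃ t₄ : ℕ) (T m : ℝ)
    (c c' : Sym2 (Fin r) → Fin b) : Prop :=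
  (e₁ ≤ #{e ∈ edgesIn (I.image f) | c e = 0} ∨ T ≤ outsideSum c f I D) ∨
    (t₃ ≤ #{s ∈ packing c | 2 ≤ #(s ∩ I.image f)} ∨
      ((#(ebad c' f g I D) : ℝ) ≤ m ∧ t₄ ≤ #{e ∈ ebad c' f g I D | c e = 0}))

theorem card_nb_le {c : Sym2 (Fin r) → Fin b} {f : V → Fin r} {S d : ℕ} (hS : PartsLe f S)
    (hd : DegLe c d) (I : Finset V) (i : Fin r) : #(nb c f I i) ≤ S * d := by
  refine (card_le_of_partsLe hS _).trans (Nat.mul_le_mul_left _ ((card_le_card ?_).trans (hd i)))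
  intro a ha
  obtain ⟨u, hu, rfl⟩ := mem_image.mp ha
  exact mem_filter.mpr ⟨mem_univ _, (mem_filter.mp hu).2⟩

theorem hi_asg_mem_choices {c : Sym2 (Fin r) → Fin b} {f : V → Fin r} {I : Finset V}
    {S d D h : ℕ} (hS : PartsLe f S) (hd : DegLe c d) (hh : #(hi c f I D) ≤ h) :
    ⟨hi c f I D, asg c f I (hi c f I D)⟩ ∈ choices I r h (S * d) := by
  refine mem_filter.mpr ⟨mem_sigma.mpr ⟨mem_filter.mpr ⟨mem_univ _, hh⟩,
    asg_mem_assignments c f I _⟩, fun i _ => (card_le_card ?_).trans (card_nb_le hS hd I i)⟩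
  intro u hu
  exact (asg_eq_some c f I (mem_filter.mp hu).2).2

theorem allExposed_of_independent {c c' : Sym2 (Fin r) → Fin b} {f g : V → Fin r} {I : Finset V}
    {k S d K D h e₁ t₃ t₄ : ℕ} {T m : ℝ} (hI : #I = k)
    (hind : ∀ u ∈ I, ∀ v ∈ I, ¬ (biteGraph c c' f g).Adj u v)
    (hfS : PartsLe f S) (hgS : PartsLe g S) (hcd : DegLe c d) (hcd' : DegLe c' d)
    (hcK : CodegLe c K) (hcK' : CodegLe c' K)
    (h1 : 2 * ((h + 1) * (S * K)) ≤ D) (h2 : 2 * k < (h + 1) * D)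
    (hm : (k * S + T + D * (S * (2 * e₁)) + h * (2 * k * (h * (S * K))) : ℝ) ≤ m)
    (hR : ¬ Rare f g I D e₁ t₃ t₄ T m c c') (hR' : ¬ Rare g f I D e₁ t₃ t₄ T m c' c) :
    AllExposed f g I h (S * d) (t₄ + 3 * t₃) (c, c') := by
  simp only [Rare, not_or, not_and, not_le] at hR hR'
  subst hI
  have hh := card_hi_le hcK hfS h1 h2
  have hh' := card_hi_le hcK' hgS h1 h2
  have l1 := card_left_le hcK hfS hh hR.1.2.le hR.1.1.le
  have l2 := card_left_le hcK' hgS hh' hR'.1.2.le hR'.1.1.le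
  have b1 : (#(ebad c' f g I D) : ℝ) ≤ m :=
    (Nat.cast_le.mpr (card_ebad_le c' f g I D)).trans (l2.trans hm)
  have b2 : (#(ebad c g f I D) : ℝ) ≤ m :=
    (Nat.cast_le.mpr (card_ebad_le c g f I D)).trans (l1.trans hm)
  refine ⟨(⟨_, _⟩, ⟨_, _⟩), mem_product.mpr ⟨hi_asg_mem_choices hfS hcd hh,
    hi_asg_mem_choices hgS hcd' hh'⟩, ?_, ?_⟩
  · exact exposed_of_independent (fun u hu v hv h => hind u hu v hv (Or.inl h)) hR.2.1.le
      (hR.2.2 b1).le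
  · exact exposed_of_independent (fun u hu v hv h => hind u hu v hv (Or.inr h)) hR'.2.1.le
      (hR'.2.2 b2).le

theorem pr_rare_le {f g : V → Fin r} {I : Finset V} {k S D e₁ t₃ t₄ : ℕ} {T m l η : ℝ}
    (c' : Sym2 (Fin r) → Fin b) (hI : #I = k) (hS : PartsLe f S) (hl : 0 ≤ l)
    (hlD : l * D * S ≤ 1) (hm : 0 ≤ m)
    (h1 : (Real.exp 1 * k ^ 2 / (b * e₁)) ^ e₁ ≤ η)
    (h2 : Real.exp (r * (9 * l * k ^ 2 * (1 / b) ^ 2 * Real.exp (2 * (1 / b) * (l * D) * k))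
        - l * T) ≤ η)
    (h3 : (Real.exp 1 * (k ^ 2 * r) / (b ^ 3 * t₃)) ^ t₃ ≤ η)
    (h4 : (Real.exp 1 * m / (b * t₄)) ^ t₄ ≤ η) :
    pr (fun c => Rare f g I D e₁ t₃ t₄ T m c c') ≤ 4 * η := by
  subst hI
  have a1 := (pr_edgesIn_le (b := b) (I.image f) (t := e₁) card_image_le).trans h1
  have a2 := (pr_outsideSum_le (b := b) (I := I) hS (T := T) hl hlD).trans h2
  have a3 := (pr_packing_le (b := b) (I.image f) (t := t₃) card_image_le).trans h3
  have a4 := (pr_ebad_le c' f g I D (t := t₄) hm).trans h4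
  refine (pr_or_le _ _).trans ?_
  have := pr_or_le (fun c : Sym2 (Fin r) → Fin b => e₁ ≤ #{e ∈ edgesIn (I.image f) | c e = 0})
    (fun c => T ≤ outsideSum c f I D)
  have := pr_or_le (fun c : Sym2 (Fin r) → Fin b => t₃ ≤ #{s ∈ packing c | 2 ≤ #(s ∩ I.image f)})
    (fun c => (#(ebad c' f g I D) : ℝ) ≤ m ∧ t₄ ≤ #{e ∈ ebad c' f g I D | c e = 0})
  linarith

theorem exists_triangleFree_of_bounds [NeZero r] {k S d K D h e₁ t₃ t₄ : ℕ} (hk : 0 < k)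
    {θ m₁ m₂ l T m η κ e z Δ : ℝ} (hθ : 0 ≤ θ) (hθ1 : θ ≤ 1)
    (hm₁ : (Fintype.card V : ℝ) / r ≤ m₁) (hS : (1 + θ) * m₁ ≤ S + 1)
    (hp₁ : r * Real.exp (-(θ ^ 2 * m₁ / 4)) ≤ 1 / 16)
    (hm₂ : (r : ℝ) / b ≤ m₂) (hd : (1 + θ) * m₂ ≤ d + 1)
    (hp₂ : r * Real.exp (-(θ ^ 2 * m₂ / 4)) ≤ 1 / 16)
    (hp₃ : r ^ 2 * (Real.exp 1 * r / ((K + 1 : ℕ) * b ^ 2)) ^ (K + 1) ≤ 1 / 16)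
    (hD₁ : 2 * ((h + 1) * (S * K)) ≤ D) (hD₂ : 2 * k < (h + 1) * D)
    (hl : 0 ≤ l) (hlD : l * D * S ≤ 1) (hT : 0 ≤ T)
    (hm : (k * S + T + D * (S * (2 * e₁)) + h * (2 * k * (h * (S * K))) : ℝ) ≤ m)
    (h1 : (Real.exp 1 * k ^ 2 / (b * e₁)) ^ e₁ ≤ η)
    (h2 : Real.exp (r * (9 * l * k ^ 2 * (1 / b) ^ 2 * Real.exp (2 * (1 / b) * (l * D) * k))
        - l * T) ≤ η)
    (h3 : (Real.exp 1 * (k ^ 2 * r) / (b ^ 3 * t₃)) ^ t₃ ≤ η)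
    (h4 : (Real.exp 1 * m / (b * t₄)) ^ t₄ ≤ η)
    (hη : ((Fintype.card V).choose k : ℝ) * η ≤ 1 / 32)
    (hκ : 0 < κ) (hκ1 : κ ≤ 1) (he : 0 ≤ e) (he1 : e ≤ 1 / 8)
    (hM : ((S * d : ℕ) : ℝ) ≤ (1 - κ) / 2 * k) (hz : 0 < z) (hz1 : z ≤ 1)
    (hq : (1 + e) * Real.log b / k ≤ (1 / b) * (1 - z))
    (hΔ : 0 ≤ Δ) (hr : (k : ℝ) * b ≤ Real.exp Δ * r)
    (hfin : ((Fintype.card V).choose k : ℝ) *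
      ((((h : ℝ) + 1) * (r + 1) ^ h * (h + 1) ^ k) ^ 2 * ((z⁻¹) ^ (t₄ + 3 * t₃)) ^ 2 *
        Real.exp (-(Real.log b * (e * κ / 2 * k - k - 2 * h ^ 2 - 2 * (2 * h + 1)))) *
        ((k + 1) * Real.exp (k + Δ * k - Real.log b * k)) ^ 2) ≤ 1 / 16) :
    ∃ G : SimpleGraph V, G.CliqueFree 3 ∧
      ∀ I : Finset V, #I = k → ¬ ∀ u ∈ I, ∀ v ∈ I, ¬ G.Adj u v := by
  have hm0 : 0 ≤ m := le_trans (by positivity) hm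
  set 𝓘 := (univ : Finset V).powersetCard k with h𝓘
  have h𝓘card : #𝓘 = (Fintype.card V).choose k := by rw [card_powersetCard, card_univ]
  have memI : ∀ I ∈ 𝓘, #I = k := fun I hI => (mem_powersetCard.mp hI).2
  let Ω := ((V → Fin r) × (V → Fin r)) × ((Sym2 (Fin r) → Fin b) × (Sym2 (Fin r) → Fin b))
  let P₁ : Ω → Prop := fun ω => ¬ PartsLe ω.1.1 S ∨ ¬ PartsLe ω.1.2 S
  let P₂ : Ω → Prop := fun ω => ¬ DegLe ω.2.1 d ∨ ¬ DegLe ω.2.2 d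
  let P₃ : Ω → Prop := fun ω => ¬ CodegLe ω.2.1 K ∨ ¬ CodegLe ω.2.2 K
  let P₄ : Ω → Prop := fun ω => ∃ I ∈ 𝓘, (PartsLe ω.1.1 S ∧ PartsLe ω.1.2 S) ∧
    (Rare ω.1.1 ω.1.2 I D e₁ t₃ t₄ T m ω.2.1 ω.2.2 ∨
      Rare ω.1.2 ω.1.1 I D e₁ t₃ t₄ T m ω.2.2 ω.2.1)
  let P₅ : Ω → Prop := fun ω => ∃ I ∈ 𝓘,
    AllExposed ω.1.1 ω.1.2 I h (S * d) (t₄ + 3 * t₃) ω.2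
  have q₁ : pr P₁ ≤ 1 / 8 := by
    refine (pr_or_le _ _).trans ?_
    have x1 : pr (fun ω : Ω => ¬ PartsLe ω.1.1 S) ≤ 1 / 16 :=
      pr_le_of_forall_snd fun _ => pr_le_of_forall_snd fun _ =>
        (pr_not_partsLe_le hθ hθ1 hm₁ hS).trans hp₁
    have x2 : pr (fun ω : Ω => ¬ PartsLe ω.1.2 S) ≤ 1 / 16 :=
      pr_le_of_forall_snd fun _ => pr_le_of_forall_fst fun _ =>
        (pr_not_partsLe_le hθ hθ1 hm₁ hS).trans hp₁
    linarith
  have q₂ : pr P₂ ≤ 1 / 8 := by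
    refine (pr_or_le _ _).trans ?_
    have x1 : pr (fun ω : Ω => ¬ DegLe ω.2.1 d) ≤ 1 / 16 :=
      pr_le_of_forall_fst fun _ => pr_le_of_forall_snd fun _ =>
        (pr_not_degLe_le hθ hθ1 hm₂ hd).trans hp₂
    have x2 : pr (fun ω : Ω => ¬ DegLe ω.2.2 d) ≤ 1 / 16 :=
      pr_le_of_forall_fst fun _ => pr_le_of_forall_fst fun _ =>
        (pr_not_degLe_le hθ hθ1 hm₂ hd).trans hp₂
    linarith
  have q₃ : pr P₃ ≤ 1 / 8 := by
    refine (pr_or_le _ _).trans ?_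
    have x1 : pr (fun ω : Ω => ¬ CodegLe ω.2.1 K) ≤ 1 / 16 :=
      pr_le_of_forall_fst fun _ => pr_le_of_forall_snd fun _ => pr_not_codegLe_le.trans hp₃
    have x2 : pr (fun ω : Ω => ¬ CodegLe ω.2.2 K) ≤ 1 / 16 :=
      pr_le_of_forall_fst fun _ => pr_le_of_forall_fst fun _ => pr_not_codegLe_le.trans hp₃
    linarith
  have hη0 : 0 ≤ η := (Real.exp_nonneg _).trans h2
  have q₄ : pr P₄ ≤ 1 / 4 := by
    refine (pr_exists_le _ _).trans ?_
    calc _ ≤ ∑ _I ∈ 𝓘, 8 * η := by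
          refine sum_le_sum fun I hI => pr_le_of_forall_fst fun ⟨f, g⟩ => ?_
          by_cases hfg : PartsLe f S ∧ PartsLe g S
          · refine (pr_mono fun ω hω => hω.2).trans ((pr_or_le _ _).trans ?_)
            have x1 : pr (fun ω : (Sym2 (Fin r) → Fin b) × (Sym2 (Fin r) → Fin b) =>
                Rare f g I D e₁ t₃ t₄ T m ω.1 ω.2) ≤ 4 * η :=
              pr_le_of_forall_snd fun c' =>
                pr_rare_le c' (memI I hI) hfg.1 hl hlD hm0 h1 h2 h3 h4
            have x2 : pr (fun ω : (Sym2 (Fin r) → Fin b) × (Sym2 (Fin r) → Fin b) =>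
                Rare g f I D e₁ t₃ t₄ T m ω.2 ω.1) ≤ 4 * η :=
              pr_le_of_forall_fst fun c' =>
                pr_rare_le c' (memI I hI) hfg.2 hl hlD hm0 h1 h2 h3 h4
            linarith
          · rw [pr_false_of_le_zero _ fun ω hω => hfg hω.1]
            positivity
      _ = 8 * (((Fintype.card V).choose k : ℝ) * η) := by
          rw [sum_const, nsmul_eq_mul, h𝓘card]
          ring
      _ ≤ 1 / 4 := by linarith
  have q₅ : pr P₅ ≤ 1 / 16 := by
    refine (pr_exists_le _ _).trans (le_trans ?_ hfin)
    rw [← h𝓘card, ← nsmul_eq_mul, ← sum_const]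
    refine sum_le_sum fun I hI => ?_
    have hIk := memI I hI
    rw [pr_prod]
    set A := (((h : ℝ) + 1) * (r + 1) ^ h * (h + 1) ^ k) ^ 2 * ((z⁻¹) ^ (t₄ + 3 * t₃)) ^ 2 *
        Real.exp (-(Real.log b * (e * κ / 2 * k - k - 2 * h ^ 2 - 2 * (2 * h + 1)))) with hA
    have hA0 : 0 ≤ A := by positivity
    have y1 : ∀ f g : V → Fin r, pr (AllExposed (b := b) f g I h (S * d) (t₄ + 3 * t₃)) ≤
        A * (Real.exp (-(Real.log b * #(I.image f))) *
          Real.exp (-(Real.log b * #(I.image g)))) := by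
      intro f g
      refine (pr_allExposed_le f g hIk hk hκ hκ1 he he1 hM _ hz hz1 hq).trans (le_of_eq ?_)
      rw [hA, mul_assoc (_ * _) (Real.exp _), ← Real.exp_add, ← Real.exp_add]
      congr 2
      ring
    have y2 := expect_exp_card_image_le (V := V) (b := b) hIk hk hΔ hr
    have y0 : 0 ≤ 𝔼 f : V → Fin r, Real.exp (-(Real.log b * #(I.image f))) :=
      expect_nonneg fun f _ => Real.exp_nonneg _
    calc _ ≤ 𝔼 x : (V → Fin r) × (V → Fin r), A * (Real.exp (-(Real.log b * #(I.image x.1))) *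
          Real.exp (-(Real.log b * #(I.image x.2)))) := expect_le_expect fun x _ => y1 x.1 x.2
      _ = A * (𝔼 f : V → Fin r, Real.exp (-(Real.log b * #(I.image f)))) ^ 2 := by
          rw [← mul_expect, ← univ_product_univ, expect_product, sq, expect_mul_expect]
      _ ≤ _ := by gcongr
  have tot : pr (fun ω => ((P₁ ω ∨ P₂ ω) ∨ P₃ ω) ∨ (P₄ ω ∨ P₅ ω)) < 1 := by
    have z1 := pr_or_le (fun ω => (P₁ ω ∨ P₂ ω) ∨ P₃ ω) (fun ω => P₄ ω ∨ P₅ ω)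
    have z2 := pr_or_le (fun ω => P₁ ω ∨ P₂ ω) P₃
    have z3 := pr_or_le P₁ P₂
    have z4 := pr_or_le P₄ P₅
    linarith
  obtain ⟨⟨⟨f, g⟩, c, c'⟩, hω⟩ := exists_not_of_pr_lt_one tot
  simp only [not_or] at hω
  obtain ⟨⟨⟨g₁, g₂⟩, g₃⟩, g₄, g₅⟩ := hω
  simp only [P₁, P₂, P₃, not_or, not_not] at g₁ g₂ g₃
  refine ⟨biteGraph c c' f g, biteGraph_cliqueFree, fun I hI hind => ?_⟩
  have hmem : I ∈ 𝓘 := mem_powersetCard.mpr ⟨subset_univ _, hI⟩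
  have hR : ¬ (Rare f g I D e₁ t₃ t₄ T m c c' ∨ Rare g f I D e₁ t₃ t₄ T m c' c) :=
    fun h => g₄ ⟨I, hmem, g₁, h⟩
  rw [not_or] at hR
  exact g₅ ⟨I, hmem, allExposed_of_independent hI hind g₁.1 g₁.2 g₂.1 g₂.2 g₃.1 g₃.2 hD₁ hD₂ hm
    hR.1 hR.2⟩

end Assembly

end

section Asymptotics

lemma pow_le_exp_neg {a c y : ℝ} {t : ℕ} (ha : 0 ≤ a) (hac : a ≤ Real.exp (-c)) (hy : y ≤ t * c) :
    a ^ t ≤ Real.exp (-y) := by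
  calc a ^ t ≤ Real.exp (-c) ^ t := pow_le_pow_left₀ ha hac t
    _ = Real.exp (-(t * c)) := by rw [← Real.exp_nat_mul]; congr 1; ring
    _ ≤ Real.exp (-y) := Real.exp_le_exp.2 (by linarith)

lemma exp_one_mul_div_le {u v c : ℝ} (hv : 0 < v) (h : 3 * u * Real.exp c ≤ v) (hu : 0 ≤ u) :
    Real.exp 1 * u / v ≤ Real.exp (-c) := by
  rw [div_le_iff₀ hv, Real.exp_neg, inv_mul_eq_div, le_div_iff₀ (Real.exp_pos c)]
  have := Real.exp_one_lt_d9
  have h2 : Real.exp 1 * u ≤ 3 * u := by nlinarith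
  nlinarith [Real.exp_pos c]

lemma exp_neg_three_le : Real.exp (-3) ≤ 1 / 16 := by
  rw [Real.exp_neg, inv_eq_one_div]
  apply one_div_le_one_div_of_le (by norm_num)
  have h := Real.exp_one_gt_d9
  have : Real.exp 3 = Real.exp 1 ^ 3 := by rw [← Real.exp_nat_mul]; norm_num
  rw [this]
  calc (16 : ℝ) ≤ 2.7 ^ 3 := by norm_num
    _ ≤ _ := by gcongr; linarith

lemma exp_neg_four_le : Real.exp (-4) ≤ 1 / 32 := by
  have h : Real.exp (-4) = Real.exp (-3) * Real.exp (-1) := by rw [← Real.exp_add]; norm_num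
  have h1 : Real.exp (-1) ≤ 1 / 2 := by
    rw [Real.exp_neg, inv_eq_one_div]
    apply one_div_le_one_div_of_le (by norm_num)
    have h := Real.exp_one_gt_d9
    linarith
  rw [h]
  nlinarith [exp_neg_three_le, Real.exp_pos (-3), Real.exp_pos (-1)]

lemma exp_one_lt_three : Real.exp 1 < 3 := by
  have := Real.exp_one_lt_d9
  linarith

lemma numeric_e₁ {x ℓ b : ℝ} {e₁ : ℕ} (hx : 0 < x) (hℓ : 200 ≤ ℓ) (hb : x ≤ 2 * ℓ * b)
    (he : x * ℓ ^ 2 ≤ e₁) :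
    (Real.exp 1 * x ^ 2 / (b * e₁)) ^ e₁ ≤ Real.exp (-(3 * x * ℓ)) := by
  have hb0 : 0 < b := by by_contra h; nlinarith
  have he0 : (0 : ℝ) < e₁ := lt_of_lt_of_le (by positivity) he
  refine pow_le_exp_neg (c := 1) (by positivity) ?_ ?_
  · refine exp_one_mul_div_le (by positivity) ?_ (by positivity)
    have h1 : b * (x * ℓ ^ 2) ≤ b * e₁ := by gcongr
    have h2 : x * (x * ℓ) ≤ 2 * ℓ * b * (x * ℓ) := by gcongr
    have h3 : 3 * x ^ 2 * Real.exp 1 ≤ 3 * x ^ 2 * 3 := by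
      have := exp_one_lt_three.le
      gcongr
    have h4 : x ^ 2 * 200 ≤ x ^ 2 * ℓ := by gcongr
    nlinarith [sq_nonneg x]
  · have : x * ℓ * 200 ≤ x * ℓ * ℓ := by gcongr
    nlinarith [mul_pos hx (show 0 < ℓ by linarith)]

lemma numeric_t₃ {x ℓ b r δ : ℝ} {t : ℕ} (hx : 0 < x) (hℓ : 200 ≤ ℓ) (hb : x ≤ 2 * ℓ * b)
    (hr0 : 0 ≤ r) (hr : r * ℓ ^ 4 ≤ x ^ 2) (hδ : 0 < δ) (hδℓ : 60 * Real.exp (3 / δ) ≤ δ * ℓ)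
    (ht : δ * x * ℓ ≤ t) :
    (Real.exp 1 * (x ^ 2 * r) / (b ^ 3 * t)) ^ t ≤ Real.exp (-(3 * x * ℓ)) := by
  have hb0 : 0 < b := by by_contra h; nlinarith
  have hℓ0 : 0 < ℓ := by linarith
  have ht0 : (0 : ℝ) < t := lt_of_lt_of_le (by positivity) ht
  refine pow_le_exp_neg (c := 3 / δ) (by positivity) ?_ ?_
  · refine exp_one_mul_div_le (by positivity) ?_ (by positivity)
    have h1 : b ^ 3 * (δ * x * ℓ) ≤ b ^ 3 * t := by gcongr
    have h2 : x ^ 3 ≤ (2 * ℓ * b) ^ 3 := by gcongr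
    have hE := Real.exp_pos (3 / δ)
    refine le_trans ?_ h1
    have h3 : r * ℓ ^ 4 * (24 * Real.exp (3 / δ)) * x ^ 2
        ≤ x ^ 2 * (24 * Real.exp (3 / δ)) * x ^ 2 := by
      gcongr
    have h4 : x ^ 4 * (24 * Real.exp (3 / δ)) ≤ x ^ 4 * (δ * ℓ) :=
      mul_le_mul_of_nonneg_left (by linarith) (by positivity)
    have h5 : x ^ 3 * (x * (δ * ℓ)) ≤ (2 * ℓ * b) ^ 3 * (x * (δ * ℓ)) := by gcongr
    have h6 : (3 * (x ^ 2 * r) * Real.exp (3 / δ)) * (8 * ℓ ^ 4)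
        ≤ (b ^ 3 * (δ * x * ℓ)) * (8 * ℓ ^ 3) := by
      nlinarith
    have h7 : (b ^ 3 * (δ * x * ℓ)) * (8 * ℓ ^ 3) ≤ (b ^ 3 * (δ * x * ℓ)) * (8 * ℓ ^ 4) := by
      have : ℓ ^ 3 ≤ ℓ ^ 4 := pow_le_pow_right₀ (by linarith) (by norm_num)
      gcongr
    exact le_of_mul_le_mul_right (h6.trans h7) (by positivity)
  · rw [← mul_div_assoc, le_div_iff₀ hδ]
    nlinarith

lemma numeric_t₄ {x ℓ b m δ : ℝ} {t : ℕ} (hx : 0 < x) (hℓ : 200 ≤ ℓ) (hb : x ≤ 2 * ℓ * b)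
    (hm0 : 0 ≤ m) (hm : m * ℓ = 10 * x ^ 2) (hδ : 0 < δ) (hδℓ : 60 * Real.exp (3 / δ) ≤ δ * ℓ)
    (ht : δ * x * ℓ ≤ t) :
    (Real.exp 1 * m / (b * t)) ^ t ≤ Real.exp (-(3 * x * ℓ)) := by
  have hb0 : 0 < b := by by_contra h; nlinarith
  have hℓ0 : 0 < ℓ := by linarith
  have ht0 : (0 : ℝ) < t := lt_of_lt_of_le (by positivity) ht
  refine pow_le_exp_neg (c := 3 / δ) (by positivity) ?_ ?_
  · refine exp_one_mul_div_le (by positivity) ?_ (by positivity)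
    have h1 : b * (δ * x * ℓ) ≤ b * t := by gcongr
    have hE := Real.exp_pos (3 / δ)
    refine le_trans ?_ h1
    have h4 : x ^ 2 * (60 * Real.exp (3 / δ)) ≤ x ^ 2 * (δ * ℓ) := by gcongr
    have h5 : x * (x * (δ * ℓ)) ≤ (2 * ℓ * b) * (x * (δ * ℓ)) := by gcongr
    refine le_of_mul_le_mul_right (?_ : _ * (2 * ℓ) ≤ _ * (2 * ℓ)) (by positivity)
    nlinarith
  · rw [← mul_div_assoc, le_div_iff₀ hδ]
    nlinarith

lemma numeric_exp_moment {x ℓ b r D : ℝ} (hx : 0 < x) (hℓ : 200 ≤ ℓ) (hb : x ≤ 2 * ℓ * b)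
    (hr : r * ℓ ^ 4 ≤ x ^ 2) (hD0 : 0 ≤ D) (hD : D * ℓ ^ 6 ≤ x) :
    Real.exp (r * (9 * (ℓ ^ 3 / x) * x ^ 2 * (1 / b) ^ 2
      * Real.exp (2 * (1 / b) * ((ℓ ^ 3 / x) * D) * x)) - ℓ ^ 3 / x * (x ^ 2 / ℓ))
      ≤ Real.exp (-(3 * x * ℓ)) := by
  have hb0 : 0 < b := by by_contra h; nlinarith
  have hℓ0 : 0 < ℓ := by linarith
  apply Real.exp_le_exp.2
  have hbi : 1 / b ≤ 2 * ℓ / x := by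
    rw [div_le_div_iff₀ hb0 hx]; linarith
  have hDl : ℓ ^ 3 / x * D ≤ 1 / ℓ ^ 3 := by
    rw [div_mul_eq_mul_div, div_le_div_iff₀ hx (by positivity)]
    nlinarith
  have hE : Real.exp (2 * (1 / b) * ((ℓ ^ 3 / x) * D) * x) ≤ 3 := by
    have : 2 * (1 / b) * ((ℓ ^ 3 / x) * D) * x ≤ 1 := by
      calc 2 * (1 / b) * ((ℓ ^ 3 / x) * D) * x ≤ 2 * (2 * ℓ / x) * (1 / ℓ ^ 3) * x := by gcongr
        _ = 4 / ℓ ^ 2 := by field_simp; ring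
        _ ≤ 1 := by rw [div_le_one (by positivity)]; nlinarith
    exact (Real.exp_le_exp.2 this).trans exp_one_lt_three.le
  have hrr : r ≤ x ^ 2 / ℓ ^ 4 := by rwa [le_div_iff₀ (by positivity)]
  calc _ ≤ (x ^ 2 / ℓ ^ 4) * (9 * (ℓ ^ 3 / x) * x ^ 2 * (2 * ℓ / x) ^ 2 * 3)
        - ℓ ^ 3 / x * (x ^ 2 / ℓ) := by gcongr
    _ = 108 * (x * ℓ) - (x * ℓ) * ℓ := by field_simp; ring
    _ ≤ _ := by nlinarith [mul_pos hx hℓ0]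

lemma numeric_split {x ℓ T : ℝ} {k S D e₁ h K : ℝ} (hk : k = x) (hx : 0 < x) (hℓ : 200 ≤ ℓ)
    (hlx : ℓ ^ 40 ≤ x) (hT : T = x ^ 2 / ℓ) (hS0 : 0 ≤ S) (hS : S ≤ ℓ ^ 3)
    (hD : D * ℓ ^ 6 ≤ x) (he0 : 0 ≤ e₁) (he : e₁ ≤ 2 * x * ℓ ^ 2)
    (hh0 : 0 ≤ h) (hh : h ≤ ℓ ^ 8) (hK0 : 0 ≤ K) (hK : K ≤ ℓ ^ 2) :
    k * S + T + D * (S * (2 * e₁)) + h * (2 * k * (h * (S * K))) ≤ 10 * x ^ 2 / ℓ := by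
  subst hk hT
  have hℓ0 : 0 < ℓ := by linarith
  have hD' : D ≤ k / ℓ ^ 6 := by rwa [le_div_iff₀ (by positivity)]
  have h1 : k * S + k ^ 2 / ℓ + D * (S * (2 * e₁)) + h * (2 * k * (h * (S * K)))
      ≤ k * ℓ ^ 3 + k ^ 2 / ℓ + (k / ℓ ^ 6) * (ℓ ^ 3 * (2 * (2 * k * ℓ ^ 2)))
        + ℓ ^ 8 * (2 * k * (ℓ ^ 8 * (ℓ ^ 3 * ℓ ^ 2))) := by gcongr
  refine h1.trans ?_
  have h2 : k / ℓ ^ 6 * (ℓ ^ 3 * (2 * (2 * k * ℓ ^ 2))) = 4 * (k ^ 2 / ℓ) := by field_simp; ring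
  have h3 : k * ℓ ^ 3 ≤ k ^ 2 / ℓ := by
    rw [le_div_iff₀ hℓ0]
    have : ℓ ^ 4 ≤ ℓ ^ 40 := pow_le_pow_right₀ (by linarith) (by norm_num)
    nlinarith
  have h4 : ℓ ^ 8 * (2 * k * (ℓ ^ 8 * (ℓ ^ 3 * ℓ ^ 2))) ≤ 2 * (k ^ 2 / ℓ) := by
    rw [← mul_div_assoc, le_div_iff₀ hℓ0]
    have : ℓ ^ 22 ≤ ℓ ^ 40 := pow_le_pow_right₀ (by linarith) (by norm_num)
    nlinarith
  have h5 : 10 * k ^ 2 / ℓ = 10 * (k ^ 2 / ℓ) := by ring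
  have h6 : 0 ≤ k ^ 2 / ℓ := by positivity
  linarith

lemma numeric_p₁ {x ℓ r m θ : ℝ} (hx : x = Real.exp ℓ) (hℓ : 200 ≤ ℓ) (hr : r ≤ x ^ 2)
    (hθℓ : 100 ≤ θ ^ 2 * ℓ) (hm : ℓ ^ 3 / 3 ≤ m) :
    r * Real.exp (-(θ ^ 2 * m / 4)) ≤ 1 / 16 := by
  have hℓ0 : 0 < ℓ := by linarith
  have h2 : θ ^ 2 * (ℓ ^ 3 / 3) ≤ θ ^ 2 * m := by gcongr
  have h3 : 100 * ℓ ≤ θ ^ 2 * ℓ * ℓ := by gcongr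
  have h4 : θ ^ 2 * ℓ * ℓ * 1 ≤ θ ^ 2 * ℓ * ℓ * ℓ := by
    gcongr; linarith
  calc r * Real.exp (-(θ ^ 2 * m / 4)) ≤ Real.exp ℓ ^ 2 * Real.exp (-(θ ^ 2 * m / 4)) := by
        rw [hx] at hr; gcongr
    _ = Real.exp (2 * ℓ - θ ^ 2 * m / 4) := by
        rw [← Real.exp_nat_mul, ← Real.exp_add]; congr 1
    _ ≤ Real.exp (-3) := Real.exp_le_exp.2 (by nlinarith)
    _ ≤ _ := exp_neg_three_le

lemma numeric_p₃ {x ℓ r b : ℝ} {K : ℕ} (hx : x = Real.exp ℓ) (hℓ : 200 ≤ ℓ) (hr0 : 0 ≤ r)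
    (hr : r * ℓ ^ 4 ≤ x ^ 2) (hb : x ≤ 2 * ℓ * b) (hK : 5 * ℓ ≤ K) :
    r ^ 2 * (Real.exp 1 * r / ((K + 1 : ℕ) * b ^ 2)) ^ (K + 1) ≤ 1 / 16 := by
  have hx0 : 0 < x := hx ▸ Real.exp_pos _
  have hℓ0 : 0 < ℓ := by linarith
  have hb0 : 0 < b := by by_contra h; nlinarith
  have h1 : r ≤ x ^ 2 := by
    have : (1 : ℝ) ≤ ℓ ^ 4 := one_le_pow₀ (by linarith)
    nlinarith
  have h2 : (Real.exp 1 * r / ((K + 1 : ℕ) * b ^ 2)) ^ (K + 1) ≤ Real.exp (-(5 * ℓ)) := by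
    refine pow_le_exp_neg (c := 1) (by positivity) ?_ (by push_cast; linarith)
    refine exp_one_mul_div_le (by positivity) ?_ hr0
    have h3 : x ^ 2 ≤ (2 * ℓ * b) ^ 2 := by gcongr
    have h4 : r * ℓ ^ 2 ≤ 4 * b ^ 2 := by
      refine le_of_mul_le_mul_right (?_ : _ * ℓ ^ 2 ≤ _ * ℓ ^ 2) (by positivity)
      nlinarith
    have h5 : 3 * r * Real.exp 1 ≤ 3 * r * 3 := by
      have := exp_one_lt_three.le
      gcongr
    have h6 : r * 200 ^ 2 ≤ r * ℓ ^ 2 := by gcongr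
    have h7 : 1 * b ^ 2 ≤ ((K + 1 : ℕ) : ℝ) * b ^ 2 := by
      gcongr
      push_cast
      linarith
    nlinarith
  calc r ^ 2 * (Real.exp 1 * r / ((K + 1 : ℕ) * b ^ 2)) ^ (K + 1)
      ≤ (Real.exp ℓ ^ 2) ^ 2 * Real.exp (-(5 * ℓ)) := by rw [← hx]; gcongr
    _ = Real.exp (-ℓ) := by
        rw [← pow_mul, ← Real.exp_nat_mul, ← Real.exp_add]; congr 1; push_cast; ring
    _ ≤ Real.exp (-3) := Real.exp_le_exp.2 (by linarith)
    _ ≤ _ := exp_neg_three_le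

lemma numeric_choose {x ℓ : ℝ} {n k : ℕ} (hk : (k : ℝ) = x) (hx : x = Real.exp ℓ) (hℓ : 200 ≤ ℓ)
    (hn : (n : ℝ) ≤ x ^ 2) :
    (n.choose k : ℝ) * Real.exp (-(3 * x * ℓ)) ≤ 1 / 32 := by
  have h1 : (n.choose k : ℝ) ≤ Real.exp (2 * x * ℓ) := by
    calc (n.choose k : ℝ) ≤ (n : ℝ) ^ k := by exact_mod_cast Nat.choose_le_pow n k
      _ ≤ (Real.exp ℓ ^ 2) ^ k := by rw [← hx]; gcongr
      _ = _ := by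
        rw [← pow_mul, ← Real.exp_nat_mul]; congr 1; push_cast; rw [hk]
  have h2 : 1 ≤ x := by rw [hx]; exact Real.one_le_exp (by linarith)
  calc (n.choose k : ℝ) * Real.exp (-(3 * x * ℓ))
      ≤ Real.exp (2 * x * ℓ) * Real.exp (-(3 * x * ℓ)) := by gcongr
    _ = Real.exp (-(x * ℓ)) := by rw [← Real.exp_add]; congr 1; ring
    _ ≤ Real.exp (-4) := Real.exp_le_exp.2 (by nlinarith)
    _ ≤ _ := exp_neg_four_le

lemma numeric_exponent {x ℓ L u ε h t : ℝ} (hε : 0 < ε) (hu : 1 ≤ u) (huℓ : u ≤ ℓ)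
    (hMu : 34 * 64 * u ≤ ε ^ 2 * ℓ) (hεℓ : 32 / ε ≤ ℓ) (hℓ : 200 ≤ ℓ) (hlx : ℓ ^ 40 ≤ x)
    (hL1 : ℓ / 2 ≤ L) (hL2 : L ≤ ℓ) (hh0 : 0 ≤ h) (hh : h + 1 ≤ ℓ ^ 8)
    (ht : t ≤ 4 * (ε ^ 3 / 1024 * x * ℓ + 1)) :
    (x + 4 * u * x + L * x) + 2 * (8 * u + 2 * ℓ * h + 8 * u * x) + 2 * (t * (4 / ε))
      - L * (ε / 2 * (ε / 2) / 2 * x - x - 2 * h ^ 2 - 2 * (2 * h + 1))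
      + 2 * (x + (x + 4 * u * x - L * x)) ≤ -3 := by
  have hℓ0 : 0 < ℓ := by linarith
  have hx : 0 < x := lt_of_lt_of_le (by positivity) hlx
  have ht' : t * (4 / ε) ≤ ε ^ 2 / 64 * x * ℓ + 16 / ε := by
    calc t * (4 / ε) ≤ 4 * (ε ^ 3 / 1024 * x * ℓ + 1) * (4 / ε) := by gcongr
      _ = _ := by field_simp; ring
  have h1 : L * (2 * (h + 1) ^ 2) ≤ ℓ * (2 * (ℓ ^ 8) ^ 2) := by gcongr
  have h2 : ℓ * h ≤ ℓ * ℓ ^ 8 := by gcongr; linarith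
  have h3 : ℓ / 2 * (ε ^ 2 / 8 * x) ≤ L * (ε ^ 2 / 8 * x) := by gcongr
  have h4 : 34 * 64 * u * x ≤ ε ^ 2 * ℓ * x := by gcongr
  have h5 : ℓ ≤ ℓ ^ 17 := le_self_pow₀ (by linarith) (by norm_num)
  have h6 : ℓ ^ 9 ≤ ℓ ^ 17 := pow_le_pow_right₀ (by linarith) (by norm_num)
  have h7 : 29 * ℓ ^ 17 ≤ x := by
    have : ℓ ^ 18 ≤ ℓ ^ 40 := pow_le_pow_right₀ (by linarith) (by norm_num)
    have : 200 * ℓ ^ 17 ≤ ℓ * ℓ ^ 17 := by gcongr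
    nlinarith [pow_pos hℓ0 17]
  have h8 : 1 * x ≤ u * x := by gcongr
  have h9 : 1 ≤ x := by nlinarith [pow_pos hℓ0 17]
  have h10 : 16 / ε = (32 / ε) / 2 := by ring
  have h11 : ℓ * ℓ ^ 8 = ℓ ^ 9 := by ring
  have h12 : ℓ * (2 * (ℓ ^ 8) ^ 2) = 2 * ℓ ^ 17 := by ring
  rw [h11] at h2
  rw [h12] at h1
  nlinarith

lemma numeric_final {n k r b h t₃ t₄ : ℕ} {x ℓ u ε : ℝ} (hε : 0 < ε) (hk : (k : ℝ) = x)
    (hx : x = Real.exp ℓ) (hℓu : ℓ = Real.exp u) (hu : 1 ≤ u)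
    (hMu : 34 * 64 * u ≤ ε ^ 2 * ℓ) (hεℓ : 32 / ε ≤ ℓ) (hℓ : 200 ≤ ℓ) (hlx : ℓ ^ 40 ≤ x)
    (hb : 0 < b) (hL1 : ℓ / 2 ≤ Real.log b) (hL2 : Real.log b ≤ ℓ)
    (hh : (h : ℝ) + 1 ≤ ℓ ^ 8) (hr : (r : ℝ) + 1 ≤ x ^ 2)
    (hn : (n : ℝ) ≤ Real.exp (4 * u) * b * x)
    (ht₃ : (t₃ : ℝ) ≤ ε ^ 3 / 1024 * x * ℓ + 1) (ht₄ : (t₄ : ℝ) ≤ ε ^ 3 / 1024 * x * ℓ + 1)  :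
    (n.choose k : ℝ) * ((((h : ℝ) + 1) * (r + 1) ^ h * (h + 1) ^ k) ^ 2
      * (((ε / 4)⁻¹) ^ (t₄ + 3 * t₃)) ^ 2
      * Real.exp (-(Real.log b * (ε / 2 * (ε / 2) / 2 * k - k - 2 * h ^ 2 - 2 * (2 * h + 1))))
      * ((k + 1) * Real.exp (k + 4 * u * k - Real.log b * k)) ^ 2) ≤ 1 / 16 := by
  have hx0 : 0 < x := hx ▸ Real.exp_pos _
  have huℓ : u ≤ ℓ := by have := Real.add_one_le_exp u; linarith
  have hb' : (b : ℝ) = Real.exp (Real.log b) := (Real.exp_log (by exact_mod_cast hb)).symm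
  set L := Real.log b with hLdef
  have c1 : (n.choose k : ℝ) ≤ Real.exp (x + 4 * u * x + L * x) := by
    calc (n.choose k : ℝ) ≤ (Real.exp 1 * n / k) ^ k := choose_le_exp_mul_div_pow n k
      _ ≤ (Real.exp 1 * (Real.exp (4 * u) * Real.exp L)) ^ k := by
        rw [mul_div_assoc]
        gcongr
        rw [hk, div_le_iff₀ hx0, ← hb']
        exact hn
      _ = _ := by
        rw [← Real.exp_add, ← Real.exp_add, ← Real.exp_nat_mul, hk]; congr 1; ring
  have hh8 : (h : ℝ) + 1 ≤ Real.exp (8 * u) := by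
    rw [hℓu, ← Real.exp_nat_mul] at hh
    exact_mod_cast hh
  have hr2 : (r : ℝ) + 1 ≤ Real.exp (2 * ℓ) := by
    rw [hx, ← Real.exp_nat_mul] at hr
    exact_mod_cast hr
  have c2 : (((h : ℝ) + 1) * (r + 1) ^ h * (h + 1) ^ k) ^ 2
      ≤ Real.exp (2 * (8 * u + 2 * ℓ * h + 8 * u * x)) := by
    calc (((h : ℝ) + 1) * (r + 1) ^ h * (h + 1) ^ k) ^ 2
        ≤ (Real.exp (8 * u) * Real.exp (2 * ℓ) ^ h * Real.exp (8 * u) ^ k) ^ 2 := by gcongr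
      _ = _ := by
        rw [← Real.exp_nat_mul, ← Real.exp_nat_mul, ← Real.exp_add, ← Real.exp_add,
          ← Real.exp_nat_mul, hk]
        congr 1
        push_cast
        ring
  have c3 : (((ε / 4)⁻¹) ^ (t₄ + 3 * t₃)) ^ 2
      ≤ Real.exp (2 * (((t₄ + 3 * t₃ : ℕ) : ℝ) * (4 / ε))) := by
    have : (ε / 4)⁻¹ ≤ Real.exp (4 / ε) := by
      rw [inv_div]
      have := Real.add_one_le_exp (4 / ε)
      linarith
    calc (((ε / 4)⁻¹) ^ (t₄ + 3 * t₃)) ^ 2 ≤ (Real.exp (4 / ε) ^ (t₄ + 3 * t₃)) ^ 2 := by gcongr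
      _ = _ := by
        rw [← Real.exp_nat_mul, ← Real.exp_nat_mul]; norm_num
  have c4 : (((k : ℝ) + 1) * Real.exp (k + 4 * u * k - L * k)) ^ 2
      ≤ Real.exp (2 * (x + (x + 4 * u * x - L * x))) := by
    calc (((k : ℝ) + 1) * Real.exp (k + 4 * u * k - L * k)) ^ 2
        ≤ (Real.exp k * Real.exp (k + 4 * u * k - L * k)) ^ 2 := by
          have := Real.add_one_le_exp (k : ℝ)
          gcongr
      _ = _ := by rw [← Real.exp_add, ← Real.exp_nat_mul, hk]; norm_num
  calc _ ≤ Real.exp (x + 4 * u * x + L * x) * (Real.exp (2 * (8 * u + 2 * ℓ * h + 8 * u * x))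
      * Real.exp (2 * (((t₄ + 3 * t₃ : ℕ) : ℝ) * (4 / ε)))
      * Real.exp (-(L * (ε / 2 * (ε / 2) / 2 * k - k - 2 * h ^ 2 - 2 * (2 * h + 1))))
      * Real.exp (2 * (x + (x + 4 * u * x - L * x)))) := by gcongr
    _ = Real.exp ((x + 4 * u * x + L * x) + 2 * (8 * u + 2 * ℓ * h + 8 * u * x)
      + 2 * (((t₄ + 3 * t₃ : ℕ) : ℝ) * (4 / ε))
      - L * (ε / 2 * (ε / 2) / 2 * x - x - 2 * h ^ 2 - 2 * (2 * h + 1))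
      + 2 * (x + (x + 4 * u * x - L * x))) := by
        simp only [← Real.exp_add]
        rw [hk]
        congr 1
        ring
    _ ≤ Real.exp (-3) := Real.exp_le_exp.2 (numeric_exponent hε hu huℓ hMu hεℓ hℓ hlx hL1 hL2
        (Nat.cast_nonneg h) hh (by push_cast; linarith))
    _ ≤ _ := exp_neg_three_le

set_option maxHeartbeats 1000000 in
lemma exists_triangleFree_of_large {n k : ℕ} {ε ℓ u : ℝ} (hε : 0 < ε) (hε1 : ε ≤ 1 / 10)
    (hx : (k : ℝ) = Real.exp ℓ) (hℓu : ℓ = Real.exp u) (hu : 1 ≤ u)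
    (hMu : 34 * 64 * u ≤ ε ^ 2 * ℓ) (hεℓ : 32 / ε ≤ ℓ) (hℓ : 200 ≤ ℓ) (hlx : ℓ ^ 40 ≤ k)
    (hδℓ : 60 * Real.exp (3 / (ε ^ 3 / 1024)) ≤ ε ^ 3 / 1024 * ℓ)
    (hθℓ : 100 ≤ (ε / 10) ^ 2 * ℓ)
    (hn1 : (k : ℝ) ^ 2 / (3 * ℓ) ≤ n) (hn2 : (n : ℝ) ≤ (1 / 2 - ε) * (k : ℝ) ^ 2 / ℓ) :
    ∃ G : SimpleGraph (Fin n), G.CliqueFree 3 ∧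
      ∀ I : Finset (Fin n), #I = k → ¬ ∀ u ∈ I, ∀ v ∈ I, ¬ G.Adj u v := by
  obtain ⟨x, hkx⟩ : ∃ x : ℝ, (k : ℝ) = x := ⟨_, rfl⟩
  have hxk := hkx
  rw [hkx] at hx hlx hn1 hn2
  have hℓ0 : 0 < ℓ := by linarith
  have hx0 : 0 < x := hx ▸ Real.exp_pos _
  have hpow : ∀ i : ℕ, i ≤ 40 → ℓ ^ i ≤ x := fun i hi =>
    (pow_le_pow_right₀ (by linarith) hi).trans hlx
  have hx200 : 200 ≤ x := by have := hpow 1 (by norm_num); linarith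
  have hk0 : 0 < k := by
    have : (0 : ℝ) < k := hkx ▸ hx0
    exact_mod_cast this
  -- the number of colours
  obtain ⟨b, hbdef⟩ : ∃ b, b = ⌊x / ((1 + ε) * ℓ)⌋₊ := ⟨_, rfl⟩
  have hb1 : (b : ℝ) * ((1 + ε) * ℓ) ≤ x := by
    rw [← le_div_iff₀ (by positivity), hbdef]
    exact Nat.floor_le (by positivity)
  have hb2 : x ≤ ((b : ℝ) + 1) * ((1 + ε) * ℓ) := by
    rw [← div_le_iff₀ (by positivity), hbdef]
    exact (Nat.lt_floor_add_one _).le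
  have h10 : 10 ≤ ε * ℓ := by
    rw [div_le_iff₀ hε] at hεℓ
    linarith
  have hbig : ℓ ≤ b := by
    have h3 : ℓ ^ 3 ≤ x := hpow 3 (by norm_num)
    have h4 : ((b : ℝ) + 1) * ((1 + ε) * ℓ) ≤ (b + 1) * (2 * ℓ) := by gcongr; linarith
    have h5 : ℓ * ℓ ^ 2 ≤ ℓ * (2 * (b + 1)) := by nlinarith only [h3, hb2, h4]
    have h6 := le_of_mul_le_mul_left h5 hℓ0
    nlinarith only [h6, hℓ]
  have hb0 : (0 : ℝ) < b := by linarith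
  have hb3 : x ≤ (1 + ε / 10) * (1 + ε) * ℓ * b := by
    have : (b : ℝ) + 1 ≤ (1 + ε / 10) * b := by
      nlinarith only [h10, mul_le_mul_of_nonneg_left hbig hε.le]
    calc x ≤ ((b : ℝ) + 1) * ((1 + ε) * ℓ) := hb2
      _ ≤ (1 + ε / 10) * b * ((1 + ε) * ℓ) := by gcongr
      _ = _ := by ring
  have hb4 : x ≤ 2 * ℓ * b := by
    have : (1 + ε / 10) * (1 + ε) ≤ 2 := by nlinarith only [hε, hε1]
    calc x ≤ (1 + ε / 10) * (1 + ε) * ℓ * b := hb3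
      _ ≤ _ := by gcongr
  have hb5 : b * ℓ ≤ x := by nlinarith only [hb1, mul_pos hb0 (mul_pos hε hℓ0)]
  -- the number of parts
  obtain ⟨r, hrdef⟩ : ∃ r, r = ⌊x ^ 2 / ℓ ^ 4⌋₊ := ⟨_, rfl⟩
  have hr1 : (r : ℝ) * ℓ ^ 4 ≤ x ^ 2 := by
    rw [← le_div_iff₀ (by positivity), hrdef]
    exact Nat.floor_le (by positivity)
  have hr2 : 9 / 10 * x ^ 2 ≤ r * ℓ ^ 4 := by
    have : x ^ 2 ≤ ((r : ℝ) + 1) * ℓ ^ 4 := by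
      rw [← div_le_iff₀ (by positivity), hrdef]
      exact (Nat.lt_floor_add_one _).le
    have h4 := hpow 4 (by norm_num)
    nlinarith only [this, h4, hx200, mul_le_mul_of_nonneg_right hx200 hx0.le]
  have hr0 : (0 : ℝ) < r := by
    by_contra h
    have : (r : ℝ) * ℓ ^ 4 ≤ 0 := mul_nonpos_of_nonpos_of_nonneg (by linarith) (by positivity)
    nlinarith only [this, hr2, pow_pos hx0 2]
  have hr3 : (r : ℝ) + 1 ≤ x ^ 2 := by
    have : (200 : ℝ) ≤ ℓ ^ 4 := hℓ.trans (le_self_pow₀ (by linarith) (by norm_num))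
    nlinarith only [mul_le_mul_of_nonneg_left this hr0.le, hr1, hr0, hx200,
      mul_le_mul_of_nonneg_right hx200 hx0.le]
  have hn3 : (n : ℝ) * (2 * ℓ) ≤ x ^ 2 := by
    rw [le_div_iff₀ hℓ0] at hn2
    nlinarith only [hn2, mul_nonneg hε.le (sq_nonneg x)]
  have hn0 : (0 : ℝ) < n := lt_of_lt_of_le (by positivity) hn1
  have : NeZero b := ⟨by rintro rfl; simp at hb0⟩
  have : NeZero r := ⟨by rintro rfl; simp at hr0⟩
  have : Nonempty (Fin n) := ⟨⟨0, by exact_mod_cast hn0⟩⟩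
  -- part sizes and degrees
  have hm₁l : ℓ ^ 3 / 3 ≤ (n : ℝ) / r := by
    rw [div_le_div_iff₀ (by norm_num) hr0]
    rw [div_le_iff₀ (by positivity)] at hn1
    refine le_of_mul_le_mul_right (?_ : _ * ℓ ≤ _ * ℓ) hℓ0
    nlinarith only [hr1, hn1]
  have hm₁u : (1 + ε / 10) * ((n : ℝ) / r) ≤ ℓ ^ 3 := by
    have : (n : ℝ) / r ≤ 5 / 9 * ℓ ^ 3 := by
      rw [div_le_iff₀ hr0]
      refine le_of_mul_le_mul_right (?_ : _ * (2 * ℓ) ≤ _ * (2 * ℓ)) (by positivity)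
      nlinarith only [hn3, hr2]
    have h3 : 0 < ℓ ^ 3 := by positivity
    have h4 : (0 : ℝ) ≤ n / r := by positivity
    nlinarith only [mul_le_mul_of_nonneg_right hε1 h4, this, h3]
  have hm₂l : ℓ ^ 3 / 3 ≤ (r : ℝ) / b := by
    rw [div_le_div_iff₀ (by norm_num) hb0]
    refine le_of_mul_le_mul_right (?_ : _ * ℓ ^ 4 ≤ _ * ℓ ^ 4) (by positivity)
    have h6 : ℓ ^ 6 * (b * ℓ) ≤ x * x := by
      have := hpow 6 (by norm_num)
      gcongr
    nlinarith only [h6, hr2, sq_nonneg x]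
  obtain ⟨S, hSdef⟩ : ∃ S, S = ⌊(1 + ε / 10) * ((n : ℝ) / r)⌋₊ := ⟨_, rfl⟩
  obtain ⟨d, hddef⟩ : ∃ d, d = ⌊(1 + ε / 10) * ((r : ℝ) / b)⌋₊ := ⟨_, rfl⟩
  have hS1 : (S : ℝ) ≤ (1 + ε / 10) * ((n : ℝ) / r) := by
    rw [hSdef]; exact Nat.floor_le (by positivity)
  have hS2 : (1 + ε / 10) * ((n : ℝ) / r) ≤ S + 1 := by
    rw [hSdef]; exact (Nat.lt_floor_add_one _).le
  have hd1 : (d : ℝ) ≤ (1 + ε / 10) * ((r : ℝ) / b) := by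
    rw [hddef]; exact Nat.floor_le (by positivity)
  have hd2 : (1 + ε / 10) * ((r : ℝ) / b) ≤ d + 1 := by
    rw [hddef]; exact (Nat.lt_floor_add_one _).le
  have hS3 : (S : ℝ) ≤ ℓ ^ 3 := hS1.trans hm₁u
  have hM : ((S * d : ℕ) : ℝ) ≤ (1 - ε / 2) / 2 * k := by
    push_cast
    rw [hkx]
    have hc : (1 + ε / 10) ^ 3 * (1 + ε) * (1 / 2 - ε) ≤ (1 - ε / 2) / 2 := by
      have h1 : (1 + ε / 10) ^ 3 ≤ 1 + 4 / 10 * ε := by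
        nlinarith only [hε, mul_le_mul_of_nonneg_left hε1 hε.le,
          mul_le_mul_of_nonneg_left hε1 (sq_nonneg ε)]
      have h2 : 0 ≤ (1 + ε) * (1 / 2 - ε) := mul_nonneg (by linarith) (by linarith)
      have h3 := mul_le_mul_of_nonneg_right h1 h2
      nlinarith only [h3, hε, pow_pos hε 2, pow_pos hε 3]
    calc (S : ℝ) * d ≤ (1 + ε / 10) * ((n : ℝ) / r) * ((1 + ε / 10) * ((r : ℝ) / b)) := by gcongr
      _ = (1 + ε / 10) ^ 2 * (n / b) := by field_simp
      _ ≤ (1 + ε / 10) ^ 2 * ((1 + ε / 10) * (1 + ε) * (1 / 2 - ε) * x) := by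
        gcongr
        rw [div_le_iff₀ hb0]
        refine hn2.trans ?_
        rw [div_le_iff₀ hℓ0]
        have h1 : 0 ≤ (1 / 2 - ε) * x := mul_nonneg (by linarith) hx0.le
        nlinarith only [mul_le_mul_of_nonneg_left hb3 h1]
      _ = (1 + ε / 10) ^ 3 * (1 + ε) * (1 / 2 - ε) * x := by ring
      _ ≤ _ := by gcongr
  -- auxiliary integer parameters
  obtain ⟨K, hKdef⟩ : ∃ K, K = ⌈5 * ℓ⌉₊ := ⟨_, rfl⟩
  have hK1 : 5 * ℓ ≤ K := hKdef ▸ Nat.le_ceil _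
  have hK2 : (K : ℝ) ≤ ℓ ^ 2 := by
    have : (K : ℝ) < 5 * ℓ + 1 := hKdef ▸ Nat.ceil_lt_add_one (by positivity)
    nlinarith only [this, hℓ]
  obtain ⟨h, hhdef⟩ : ∃ h, h = ⌈ℓ ^ 7⌉₊ := ⟨_, rfl⟩
  have hh1 : ℓ ^ 7 ≤ h := hhdef ▸ Nat.le_ceil _
  have hh2 : (h : ℝ) + 1 ≤ ℓ ^ 8 := by
    have : (h : ℝ) < ℓ ^ 7 + 1 := hhdef ▸ Nat.ceil_lt_add_one (by positivity)
    have h7 : 200 ≤ ℓ ^ 7 := hℓ.trans (le_self_pow₀ (by linarith) (by norm_num))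
    nlinarith only [this, h7, mul_le_mul_of_nonneg_right hℓ (show 0 ≤ ℓ ^ 7 by positivity)]
  obtain ⟨D, hDdef⟩ : ∃ D, D = ⌊x / ℓ ^ 6⌋₊ := ⟨_, rfl⟩
  have hD1 : (D : ℝ) * ℓ ^ 6 ≤ x := by
    rw [← le_div_iff₀ (by positivity), hDdef]
    exact Nat.floor_le (by positivity)
  have hD2 : 9 / 10 * x ≤ D * ℓ ^ 6 := by
    have : x ≤ ((D : ℝ) + 1) * ℓ ^ 6 := by
      rw [← div_le_iff₀ (by positivity), hDdef]
      exact (Nat.lt_floor_add_one _).le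
    have h7 := hpow 7 (by norm_num)
    have : ℓ ^ 6 * 200 ≤ ℓ ^ 7 := by
      rw [pow_succ ℓ 6]; gcongr
    linarith
  have hD₁ : 2 * ((h + 1) * (S * K)) ≤ D := by
    have : (2 * (((h : ℝ) + 1) * (S * K))) ≤ D := by
      have h1 : 2 * (((h : ℝ) + 1) * (S * K)) ≤ 2 * (ℓ ^ 8 * (ℓ ^ 3 * ℓ ^ 2)) := by gcongr
      refine h1.trans ?_
      refine le_of_mul_le_mul_right (?_ : _ * ℓ ^ 6 ≤ _ * ℓ ^ 6) (by positivity)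
      have h20 := hpow 20 (by norm_num)
      have : ℓ ^ 19 * 200 ≤ ℓ ^ 20 := by
        rw [pow_succ ℓ 19]; gcongr
      nlinarith only [hD2, h20, this, hx0]
    exact_mod_cast this
  have hD₂ : 2 * k < (h + 1) * D := by
    have : 2 * (k : ℝ) < (h + 1) * D := by
      rw [hkx]
      have h1 : ℓ ^ 7 * D ≤ (h + 1) * D := by gcongr; linarith
      have h2 : ℓ * (9 / 10 * x) ≤ ℓ * (D * ℓ ^ 6) := by gcongr
      nlinarith only [h1, h2, hx0, mul_le_mul_of_nonneg_right hℓ hx0.le]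
    exact_mod_cast this
  obtain ⟨e₁, hedef⟩ : ∃ e₁, e₁ = ⌈x * ℓ ^ 2⌉₊ := ⟨_, rfl⟩
  have he1 : x * ℓ ^ 2 ≤ e₁ := hedef ▸ Nat.le_ceil _
  have he2 : (e₁ : ℝ) ≤ 2 * x * ℓ ^ 2 := by
    have hlt : (e₁ : ℝ) < x * ℓ ^ 2 + 1 := hedef ▸ Nat.ceil_lt_add_one (by positivity)
    have hone : 1 ≤ ℓ ^ 2 := one_le_pow₀ (by linarith)
    nlinarith only [hlt, hx200, mul_le_mul_of_nonneg_left hone hx0.le]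
  obtain ⟨t, htdef⟩ : ∃ t, t = ⌈ε ^ 3 / 1024 * x * ℓ⌉₊ := ⟨_, rfl⟩
  have ht1 : ε ^ 3 / 1024 * x * ℓ ≤ t := htdef ▸ Nat.le_ceil _
  have ht2 : (t : ℝ) ≤ ε ^ 3 / 1024 * x * ℓ + 1 :=
    htdef ▸ (Nat.ceil_lt_add_one (by positivity)).le
  -- logarithm of the number of colours
  have hL2 : Real.log b ≤ ℓ := by
    rw [Real.log_le_iff_le_exp hb0, ← hx]
    nlinarith only [hb5, hb0, mul_le_mul_of_nonneg_left hℓ hb0.le]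
  have hL1 : ℓ / 2 ≤ Real.log b := by
    rw [Real.le_log_iff_exp_le hb0]
    have h1 : Real.exp (ℓ / 2) * (2 * ℓ) ≤ x := by
      have h2 : 2 * ℓ ≤ Real.exp (1 + u) := by
        rw [Real.exp_add, ← hℓu]
        have := Real.exp_one_gt_d9
        nlinarith only [this, hℓ0]
      calc Real.exp (ℓ / 2) * (2 * ℓ) ≤ Real.exp (ℓ / 2) * Real.exp (1 + u) := by gcongr
        _ = Real.exp (ℓ / 2 + (1 + u)) := by rw [← Real.exp_add]
        _ ≤ x := by
          rw [hx]
          apply Real.exp_le_exp.2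
          have : ε ^ 2 * ℓ ≤ 1 * ℓ := by gcongr; nlinarith only [hε, hε1]
          linarith
    exact le_of_mul_le_mul_right (h1.trans (by linarith)) (show 0 < 2 * ℓ by positivity)
  have hexp4 : Real.exp (4 * u) = ℓ ^ 4 := by
    rw [hℓu, ← Real.exp_nat_mul]; norm_num
  have hδ : 0 < ε ^ 3 / 1024 := by positivity
  refine exists_triangleFree_of_bounds (V := Fin n) (r := r) (b := b) (k := k) (S := S) (d := d)
    (K := K) (D := D) (h := h) (e₁ := e₁) (t₃ := t) (t₄ := t) hk0 (θ := ε / 10)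
    (m₁ := (n : ℝ) / r) (m₂ := (r : ℝ) / b) (l := ℓ ^ 3 / x) (T := x ^ 2 / ℓ)
    (m := 10 * x ^ 2 / ℓ) (η := Real.exp (-(3 * x * ℓ))) (κ := ε / 2) (e := ε / 2) (z := ε / 4)
    (Δ := 4 * u) (by positivity) (by linarith) (by simp) hS2
    (numeric_p₁ hx hℓ (by linarith) hθℓ hm₁l) le_rfl hd2
    (numeric_p₁ hx hℓ (by linarith) hθℓ hm₂l) (numeric_p₃ hx hℓ hr0.le hr1 hb4 hK1) hD₁ hD₂
    (by positivity) ?_ (by positivity) ?_ ?_ ?_ ?_ ?_ ?_ (by positivity) (by linarith)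
    (by positivity) (by linarith) hM (by positivity) (by linarith) ?_ (by positivity) ?_ ?_
  · rw [div_mul_eq_mul_div, div_mul_eq_mul_div, div_le_one hx0]
    calc ℓ ^ 3 * D * S ≤ ℓ ^ 3 * D * ℓ ^ 3 := by gcongr
      _ = D * ℓ ^ 6 := by ring
      _ ≤ x := hD1
  · exact numeric_split hkx hx0 hℓ hlx rfl (by positivity) hS3 hD1
      (by positivity) he2 (by positivity) (by linarith) (by positivity) hK2
  · rw [hkx]; exact numeric_e₁ hx0 hℓ hb4 he1
  · rw [hkx]; exact numeric_exp_moment hx0 hℓ hb4 hr1 (Nat.cast_nonneg _) hD1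
  · rw [hkx]; exact numeric_t₃ hx0 hℓ hb4 hr0.le hr1 hδ hδℓ ht1
  · exact numeric_t₄ hx0 hℓ hb4 (by positivity) (by field_simp) hδ hδℓ ht1
  · rw [Fintype.card_fin]
    exact numeric_choose hkx hx hℓ
      (by nlinarith only [hn3, hn0, mul_le_mul_of_nonneg_left hℓ hn0.le])
  · rw [hkx, one_div, inv_mul_eq_div, div_le_div_iff₀ hx0 hb0]
    have h1 : (1 + ε / 2) * Real.log b * b ≤ (1 + ε / 2) * ℓ * b := by gcongr
    have h2 : (1 - ε / 4) * (b * ((1 + ε) * ℓ)) ≤ (1 - ε / 4) * x :=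
      mul_le_mul_of_nonneg_left hb1 (by linarith)
    have h3 : (1 + ε / 2) * (ℓ * b) ≤ (1 - ε / 4) * (1 + ε) * (ℓ * b) := by
      gcongr
      nlinarith only [hε, hε1]
    nlinarith only [h1, h2, h3]
  · rw [hkx, hexp4]
    nlinarith only [hr2, mul_le_mul_of_nonneg_left hb5 hx0.le, mul_pos hx0 hb0,
      mul_le_mul_of_nonneg_left hℓ (mul_pos hx0 hb0).le]
  · rw [Fintype.card_fin]
    refine numeric_final hε hkx hx hℓu hu hMu hεℓ hℓ hlx (by exact_mod_cast hb0) hL1 hL2 hh2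
      hr3 ?_ ht2 ht2
    rw [hexp4]
    have h4 : 1 ≤ ℓ ^ 4 := one_le_pow₀ (by linarith)
    have h5 : (n : ℝ) * (2 * ℓ) ≤ b * x * (2 * ℓ) := by
      nlinarith only [hn3, mul_le_mul_of_nonneg_right hb4 hx0.le]
    have h6 := le_of_mul_le_mul_right h5 (by positivity)
    have h7 : 0 ≤ b * x := by positivity
    nlinarith only [h6, mul_le_mul_of_nonneg_right h4 h7]

open Filter in
lemma eventually_exists_triangleFree {ε : ℝ} (hε : 0 < ε) (hε1 : ε ≤ 1 / 10) :
    ∀ᶠ k : ℕ in atTop, ∀ n : ℕ, n = ⌊(1 / 2 - ε) * (k : ℝ) ^ 2 / Real.log k⌋₊ →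
      ∃ G : SimpleGraph (Fin n), G.CliqueFree 3 ∧
        ∀ I : Finset (Fin n), #I = k → ¬ ∀ u ∈ I, ∀ v ∈ I, ¬ G.Adj u v := by
  have hcast : Tendsto (fun k : ℕ => (k : ℝ)) atTop atTop := tendsto_natCast_atTop_atTop
  have hlog : Tendsto (fun k : ℕ => Real.log k) atTop atTop := Real.tendsto_log_atTop.comp hcast
  have hloglog := Real.tendsto_log_atTop.comp hlog
  have hpow : ∀ᶠ k : ℕ in atTop, Real.log k ^ 40 ≤ k := by
    have h := (Real.isLittleO_pow_log_id_atTop (n := 40)).bound (c := 1) one_pos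
    filter_upwards [hcast.eventually h, eventually_ge_atTop 1] with k hk hk1
    have : 0 ≤ Real.log k := Real.log_natCast_nonneg k
    simpa [abs_of_nonneg this] using hk
  have hll : ∀ᶠ k : ℕ in atTop, 34 * 64 * Real.log (Real.log k) ≤ ε ^ 2 * Real.log k := by
    have h := Real.isLittleO_log_id_atTop.bound (c := ε ^ 2 / (34 * 64)) (by positivity)
    filter_upwards [hlog.eventually h, hlog.eventually_ge_atTop 1] with k hk hk1
    have h1 : 0 ≤ Real.log (Real.log k) := Real.log_nonneg hk1
    simp only [id, Real.norm_eq_abs, abs_of_nonneg h1,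
      abs_of_nonneg (show 0 ≤ Real.log k by linarith)] at hk
    linarith
  filter_upwards [hpow, hll, hloglog.eventually_ge_atTop 1, hlog.eventually_ge_atTop 200,
    hlog.eventually_ge_atTop (32 / ε),
    hlog.eventually_ge_atTop (60 * Real.exp (3 / (ε ^ 3 / 1024)) / (ε ^ 3 / 1024)),
    hlog.eventually_ge_atTop (100 / (ε / 10) ^ 2), eventually_ge_atTop 1]
    with k hpow hll hu hℓ hεℓ hδ hθ hk1 n hn
  have hk0 : (0 : ℝ) < k := by exact_mod_cast hk1
  have hℓ0 : 0 < Real.log k := by linarith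
  rw [div_le_iff₀ (by positivity)] at hδ hθ
  refine exists_triangleFree_of_large hε hε1 (Real.exp_log hk0).symm (Real.exp_log hℓ0).symm hu hll
    hεℓ hℓ hpow (by linarith) (by linarith) ?_ ?_
  · have h1 : (1 / 2 - ε) * (k : ℝ) ^ 2 / Real.log k < n + 1 := hn ▸ Nat.lt_floor_add_one _
    have h2 : 4 / 10 * ((k : ℝ) ^ 2 / Real.log k) ≤ (1 / 2 - ε) * (k : ℝ) ^ 2 / Real.log k := by
      rw [mul_div_assoc]
      gcongr
      linarith
    have h3 : (20 : ℝ) ≤ (k : ℝ) ^ 2 / Real.log k := by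
      rw [le_div_iff₀ hℓ0]
      have := Real.log_le_self hk0.le
      nlinarith
    have h4 : (k : ℝ) ^ 2 / (3 * Real.log k) = (k : ℝ) ^ 2 / Real.log k / 3 := by
      field_simp
    linarith
  · rw [hn]
    exact Nat.floor_le (div_nonneg (mul_nonneg (by linarith) (by positivity)) hℓ0.le)

end Asymptotics

end TwoBites

/-- **Lower bound for `R(3,k)`.**
For every real `ε` with `0 < ε < 1/2` there exists `k₀` such that for every integer
`k ≥ k₀` there is a triangle-free simple graph on `⌊(1/2 − ε)·k²/log k⌋` vertices
containing no independent set of size `k` (equivalently,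
`R(3,k) > (1/2 − ε)·k²/log k`, i.e. `R(3,k) ≥ (1/2 + o(1))·k²/log k`). -/
theorem ramsey_three_k_lower_bound (ε : ℝ) (hε : 0 < ε) (hε' : ε < 1 / 2) :
    ∃ k₀ : ℕ, ∀ k : ℕ, k₀ ≤ k →
      ∃ G : SimpleGraph (Fin ⌊(1 / 2 - ε) * (k : ℝ) ^ 2 / Real.log k⌋₊),
        G.CliqueFree 3 ∧
        ∀ s : Finset (Fin ⌊(1 / 2 - ε) * (k : ℝ) ^ 2 / Real.log k⌋₊),
          (↑s : Set _).Pairwise (fun u v => ¬ G.Adj u v) → s.card < k := by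
  obtain ⟨k₀, hk₀⟩ := Filter.eventually_atTop.1
    (TwoBites.eventually_exists_triangleFree (ε := min ε (1 / 10)) (by positivity)
      (min_le_right _ _))
  refine ⟨k₀, fun k hk => ?_⟩
  obtain ⟨G, hG, hind⟩ := hk₀ k hk _ rfl
  have hle : ⌊(1 / 2 - ε) * (k : ℝ) ^ 2 / Real.log k⌋₊
      ≤ ⌊(1 / 2 - min ε (1 / 10)) * (k : ℝ) ^ 2 / Real.log k⌋₊ := by
    have := Real.log_natCast_nonneg k
    gcongr
    exact min_le_left _ _
  refine ⟨G.comap (Fin.castLEEmb hle),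
    hG.comap ⟨(SimpleGraph.Embedding.comap (Fin.castLEEmb hle) G).toCopy⟩, fun s hs => ?_⟩
  by_contra! hcard
  obtain ⟨t, hts, htk⟩ := Finset.exists_subset_card_eq hcard
  refine hind (t.map (Fin.castLEEmb hle)) (by rw [Finset.card_map, htk]) ?_
  simp only [Finset.mem_map, forall_exists_index, and_imp]
  rintro _ u hu rfl _ v hv rfl hadj
  refine hs (hts hu) (hts hv) ?_ hadj
  rintro rfl
  exact G.loopless.irrefl _ hadj
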